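/- arXiv:1802.02808 — 3 statements merged into one kernel-verified Lean document; each statement's English description precedes it below -/
import Mathlib

section
/- Let K ⊂ ℝ² be a convex body with C² boundary and minimal curvature κ_m, and let r > 1/κ_m. Then A(K^{*,r}) = A(K) − r·Per(K) + πr², where A denotes area and Per denotes perimeter. -/
open Metric MeasureTheory

/-- A plane curve `θ ↦ (a θ, b θ)`, parametrized by the angle `θ` of its outer normal
`(cos θ, sin θ)`, with positive continuous radius of curvature `ρ`. -/
structure IsNormalAngleArc (a b ρ : ℝ → ℝ) : Prop where
  hasDerivAt_fst : ∀ θ, HasDerivAt a (-(ρ θ * Real.sin θ)) θ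
  hasDerivAt_snd : ∀ θ, HasDerivAt b (ρ θ * Real.cos θ) θ
  continuous_radius : Continuous ρ
  radius_pos : ∀ θ, 0 < ρ θ

/-- A curve parametrized by the angle of its outer normal that closes up after one turn. -/
structure IsNormalAngleCurve (a b ρ : ℝ → ℝ) : Prop extends IsNormalAngleArc a b ρ where
  periodic_fst : Function.Periodic a (2 * Real.pi)
  periodic_snd : Function.Periodic b (2 * Real.pi)

/-- The intersection of the half-planes with outer normal `(cos θ, sin θ)` supporting the curve
`(a, b)` at parameter `θ`. -/
def supportRegion (a b : ℝ → ℝ) : Set (ℝ × ℝ) :=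
  {p | ∀ θ, p.1 * Real.cos θ + p.2 * Real.sin θ ≤ a θ * Real.cos θ + b θ * Real.sin θ}

namespace IsNormalAngleArc

variable {a b ρ : ℝ → ℝ}

theorem continuous_fst (H : IsNormalAngleArc a b ρ) : Continuous a :=
  continuous_iff_continuousAt.2 fun θ => (H.hasDerivAt_fst θ).continuousAt

theorem continuous_snd (H : IsNormalAngleArc a b ρ) : Continuous b :=
  continuous_iff_continuousAt.2 fun θ => (H.hasDerivAt_snd θ).continuousAt

theorem hasDerivAt_height (H : IsNormalAngleArc a b ρ) (θ φ : ℝ) :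
    HasDerivAt (fun φ => a φ * Real.cos θ + b φ * Real.sin θ) (ρ φ * Real.sin (θ - φ)) φ := by
  refine (((H.hasDerivAt_fst φ).mul_const (Real.cos θ)).add
    ((H.hasDerivAt_snd φ).mul_const (Real.sin θ))).congr_deriv ?_
  rw [Real.sin_sub]; ring

theorem continuous_height (H : IsNormalAngleArc a b ρ) (θ : ℝ) :
    Continuous (fun φ => a φ * Real.cos θ + b φ * Real.sin θ) :=
  continuous_iff_continuousAt.2 fun φ => (H.hasDerivAt_height θ φ).continuousAt

theorem strictAntiOn_height (H : IsNormalAngleArc a b ρ) (θ : ℝ) :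
    StrictAntiOn (fun φ => a φ * Real.cos θ + b φ * Real.sin θ) (Set.Icc θ (θ + Real.pi)) := by
  refine strictAntiOn_of_deriv_neg (convex_Icc _ _) (H.continuous_height θ).continuousOn
    fun x hx => ?_
  rw [interior_Icc] at hx
  rw [(H.hasDerivAt_height θ x).deriv]
  refine mul_neg_of_pos_of_neg (H.radius_pos x) (Real.sin_neg_of_neg_of_neg_pi_lt ?_ ?_)
  · linarith [hx.1]
  · linarith [hx.2]

end IsNormalAngleArc

namespace IsNormalAngleCurve

variable {a b ρ : ℝ → ℝ}

theorem periodic_height (H : IsNormalAngleCurve a b ρ) (θ : ℝ) :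
    Function.Periodic (fun φ => a φ * Real.cos θ + b φ * Real.sin θ) (2 * Real.pi) := fun φ => by
  simp only [H.periodic_fst φ, H.periodic_snd φ]

theorem height_lt (H : IsNormalAngleCurve a b ρ) {θ φ : ℝ}
    (hφ : φ ∈ Set.Ioo θ (θ + 2 * Real.pi)) :
    a φ * Real.cos θ + b φ * Real.sin θ < a θ * Real.cos θ + b θ * Real.sin θ := by
  set f := fun φ => a φ * Real.cos θ + b φ * Real.sin θ with hf
  have hfc : Continuous f := H.continuous_height θ
  have h1 : StrictAntiOn f (Set.Icc θ (θ + Real.pi)) := H.strictAntiOn_height θ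
  have h2 : StrictMonoOn f (Set.Icc (θ + Real.pi) (θ + 2 * Real.pi)) := by
    refine strictMonoOn_of_deriv_pos (convex_Icc _ _) hfc.continuousOn fun x hx => ?_
    rw [interior_Icc] at hx
    rw [(H.hasDerivAt_height θ x).deriv]
    refine mul_pos (H.radius_pos x) ?_
    rw [← Real.sin_add_two_pi]
    exact Real.sin_pos_of_pos_of_lt_pi (by linarith [hx.2]) (by linarith [hx.1])
  have hpi := Real.pi_pos
  change f φ < f θ
  rcases le_total φ (θ + Real.pi) with h | h
  · exact h1 ⟨le_rfl, by linarith⟩ ⟨hφ.1.le, h⟩ hφ.1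
  · have h3 := h2 ⟨h, hφ.2.le⟩ ⟨by linarith, le_rfl⟩ hφ.2
    rwa [show f (θ + 2 * Real.pi) = f θ from H.periodic_height θ θ] at h3

theorem height_le (H : IsNormalAngleCurve a b ρ) (θ φ : ℝ) :
    a φ * Real.cos θ + b φ * Real.sin θ ≤ a θ * Real.cos θ + b θ * Real.sin θ := by
  obtain ⟨y, hy, hy'⟩ := (H.periodic_height θ).exists_mem_Ico Real.two_pi_pos φ θ
  rw [hy']
  rcases hy.1.eq_or_lt with h | h
  · rw [h]
  · exact (H.height_lt ⟨h, hy.2⟩).le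

theorem eq_of_height_eq (H : IsNormalAngleCurve a b ρ) {θ φ : ℝ}
    (hθ : θ ∈ Set.Ico 0 (2 * Real.pi)) (hφ : φ ∈ Set.Ico 0 (2 * Real.pi))
    (h : a φ * Real.cos θ + b φ * Real.sin θ = a θ * Real.cos θ + b θ * Real.sin θ) :
    φ = θ := by
  rcases lt_trichotomy φ θ with hlt | heq | hgt
  · have := H.height_lt (θ := θ) (φ := φ + 2 * Real.pi)
      ⟨by linarith [hθ.2, hφ.1], by linarith⟩
    rw [H.periodic_fst, H.periodic_snd] at this
    exact absurd h this.ne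
  · exact heq
  · exact absurd h (H.height_lt ⟨hgt, by linarith [hθ.1, hφ.2]⟩).ne

theorem injOn (H : IsNormalAngleCurve a b ρ) :
    Set.InjOn (fun θ => (a θ, b θ)) (Set.Ico 0 (2 * Real.pi)) := fun θ hθ φ hφ h => by
  simp only [Prod.mk.injEq] at h
  exact (H.eq_of_height_eq hθ hφ (by rw [h.1, h.2])).symm

theorem hasDerivAt_support (H : IsNormalAngleCurve a b ρ) (θ : ℝ) :
    HasDerivAt (fun θ => a θ * Real.cos θ + b θ * Real.sin θ)
      (-(a θ * Real.sin θ) + b θ * Real.cos θ) θ := by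
  refine (((H.hasDerivAt_fst θ).mul (Real.hasDerivAt_cos θ)).add
    ((H.hasDerivAt_snd θ).mul (Real.hasDerivAt_sin θ))).congr_deriv ?_
  ring

theorem continuous_support (H : IsNormalAngleCurve a b ρ) :
    Continuous (fun θ => a θ * Real.cos θ + b θ * Real.sin θ) :=
  continuous_iff_continuousAt.2 fun θ => (H.hasDerivAt_support θ).continuousAt

/-- The derivative of the map sending `(t, θ)` to the point `(t * a θ, t * b θ)`. -/
theorem hasFDerivAt_cone (H : IsNormalAngleCurve a b ρ) (p : ℝ × ℝ) :
    HasFDerivAt (fun p : ℝ × ℝ => (p.1 * a p.2, p.1 * b p.2))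
      (LinearMap.toContinuousLinearMap (Matrix.toLin (Module.Basis.finTwoProd ℝ)
        (Module.Basis.finTwoProd ℝ)
        !![a p.2, p.1 * -(ρ p.2 * Real.sin p.2); b p.2, p.1 * (ρ p.2 * Real.cos p.2)])) p := by
  rw [Matrix.toLin_finTwoProd_toContinuousLinearMap]
  have ha := (H.hasDerivAt_fst p.2).comp_hasFDerivAt p (hasFDerivAt_snd (𝕜 := ℝ) (p := p))
  have hb := (H.hasDerivAt_snd p.2).comp_hasFDerivAt p (hasFDerivAt_snd (𝕜 := ℝ) (p := p))
  convert! (hasFDerivAt_fst.mul ha).prodMk (hasFDerivAt_fst.mul hb) using 2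
  · ext <;> simp
  · ext <;> simp

theorem supportRegion_eq (H : IsNormalAngleCurve a b ρ)
    (hpos : ∀ θ, 0 < a θ * Real.cos θ + b θ * Real.sin θ) :
    supportRegion a b = insert 0 ((fun p : ℝ × ℝ => (p.1 * a p.2, p.1 * b p.2)) ''
      (Set.Ioc (0 : ℝ) 1 ×ˢ Set.Ico 0 (2 * Real.pi))) := by
  ext y
  constructor
  · intro hy
    by_cases hy0 : y = 0
    · exact Or.inl hy0
    right
    set q : ℝ → ℝ := fun θ => (y.1 * Real.cos θ + y.2 * Real.sin θ) /
      (a θ * Real.cos θ + b θ * Real.sin θ) with hq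
    have hqc : Continuous q := by
      refine Continuous.div (by fun_prop) H.continuous_support fun θ => (hpos θ).ne'
    have hqp : Function.Periodic q (2 * Real.pi) := fun θ => by
      simp only [hq, Real.cos_add_two_pi, Real.sin_add_two_pi, H.periodic_fst θ,
        H.periodic_snd θ]
    obtain ⟨θ₁, -, hmax⟩ := isCompact_Icc.exists_isMaxOn (s := Set.Icc 0 (2 * Real.pi))
      ⟨0, le_rfl, Real.two_pi_pos.le⟩ hqc.continuousOn
    obtain ⟨θ₀, hθ₀, hqθ⟩ := hqp.exists_mem_Ico₀ Real.two_pi_pos θ₁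
    have hle : ∀ θ, q θ ≤ q θ₀ := fun θ => by
      obtain ⟨φ, hφ, hφ'⟩ := hqp.exists_mem_Ico₀ Real.two_pi_pos θ
      rw [hφ', ← hqθ]
      exact hmax ⟨hφ.1, hφ.2.le⟩
    set t := q θ₀ with ht
    have hval : y.1 * Real.cos θ₀ + y.2 * Real.sin θ₀ =
        t * (a θ₀ * Real.cos θ₀ + b θ₀ * Real.sin θ₀) := by
      exact (div_mul_cancel₀ _ (hpos θ₀).ne').symm
    have hder : -(y.1 * Real.sin θ₀) + y.2 * Real.cos θ₀ =
        t * (-(a θ₀ * Real.sin θ₀) + b θ₀ * Real.cos θ₀) := by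
      have hd : HasDerivAt (fun θ => (y.1 * Real.cos θ + y.2 * Real.sin θ) -
          t * (a θ * Real.cos θ + b θ * Real.sin θ))
          ((y.1 * -Real.sin θ₀ + y.2 * Real.cos θ₀) -
            t * (-(a θ₀ * Real.sin θ₀) + b θ₀ * Real.cos θ₀)) θ₀ :=
        (((Real.hasDerivAt_cos θ₀).const_mul _).add ((Real.hasDerivAt_sin θ₀).const_mul _)).sub
          ((H.hasDerivAt_support θ₀).const_mul t)
      have hm : IsLocalMax (fun θ => (y.1 * Real.cos θ + y.2 * Real.sin θ) -
          t * (a θ * Real.cos θ + b θ * Real.sin θ)) θ₀ := by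
        refine Filter.Eventually.of_forall fun θ => ?_
        have := (div_le_iff₀ (hpos θ)).1 (hle θ)
        simp only
        linarith
      linarith [hm.hasDerivAt_eq_zero hd]
    have hcs := Real.sin_sq_add_cos_sq θ₀
    have e1 : t * a θ₀ = y.1 := by
      linear_combination -Real.cos θ₀ * hval + Real.sin θ₀ * hder - (y.1 - t * a θ₀) * (-hcs)
    have e2 : t * b θ₀ = y.2 := by
      linear_combination -Real.sin θ₀ * hval - Real.cos θ₀ * hder - (y.2 - t * b θ₀) * (-hcs)
    refine ⟨(t, θ₀), ⟨⟨?_, ?_⟩, hθ₀⟩, Prod.ext e1 e2⟩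
    · by_contra! hneg
      have hall : ∀ θ, y.1 * Real.cos θ + y.2 * Real.sin θ ≤ 0 := fun θ => by
        have := (div_le_iff₀ (hpos θ)).1 (hle θ)
        exact this.trans (mul_nonpos_of_nonpos_of_nonneg hneg (hpos θ).le)
      refine hy0 (Prod.ext ?_ ?_)
      · have h1 := hall 0
        have h2 := hall Real.pi
        simp at h1 h2 ⊢; linarith
      · have h1 := hall (Real.pi / 2)
        have h2 := hall (-(Real.pi / 2))
        simp at h1 h2 ⊢; linarith
    · exact (div_le_one (hpos θ₀)).2 (hy θ₀)
  · rintro (rfl | ⟨⟨t, φ⟩, ⟨ht, -⟩, rfl⟩) θ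
    · simpa using (hpos θ).le
    · have h1 := H.height_le θ φ
      simp only at ht ⊢
      calc t * a φ * Real.cos θ + t * b φ * Real.sin θ
          = t * (a φ * Real.cos θ + b φ * Real.sin θ) := by ring
        _ ≤ t * (a θ * Real.cos θ + b θ * Real.sin θ) := by gcongr; exact ht.1.le
        _ ≤ _ := mul_le_of_le_one_left (hpos θ).le ht.2

theorem injOn_cone (H : IsNormalAngleCurve a b ρ)
    (hpos : ∀ θ, 0 < a θ * Real.cos θ + b θ * Real.sin θ) :
    Set.InjOn (fun p : ℝ × ℝ => (p.1 * a p.2, p.1 * b p.2))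
      (Set.Ioc (0 : ℝ) 1 ×ˢ Set.Ico 0 (2 * Real.pi)) := by
  have key : ∀ t φ t' φ' : ℝ, 0 < t' → t * a φ = t' * a φ' → t * b φ = t' * b φ' → t ≤ t' := by
    intro t φ t' φ' ht' h1 h2
    have h := H.height_le φ φ'
    refine le_of_mul_le_mul_right ?_ (hpos φ)
    calc t * (a φ * Real.cos φ + b φ * Real.sin φ)
        = t' * (a φ' * Real.cos φ + b φ' * Real.sin φ) := by
          linear_combination Real.cos φ * h1 + Real.sin φ * h2
      _ ≤ _ := by gcongr
  rintro ⟨t, φ⟩ ⟨ht, hφ⟩ ⟨t', φ'⟩ ⟨ht', hφ'⟩ h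
  simp only [Prod.mk.injEq] at h ht hφ ht' hφ'
  have e : t = t' := le_antisymm (key t φ t' φ' ht'.1 h.1 h.2) (key t' φ' t φ ht.1 h.1.symm h.2.symm)
  subst e
  have ea := mul_left_cancel₀ ht.1.ne' h.1
  have eb := mul_left_cancel₀ ht.1.ne' h.2
  rw [H.injOn hφ hφ' (Prod.ext ea eb)]

theorem volume_supportRegion_of_pos (H : IsNormalAngleCurve a b ρ)
    (hpos : ∀ θ, 0 < a θ * Real.cos θ + b θ * Real.sin θ) :
    (volume (supportRegion a b)).toReal = 1 / 2 *
      ∫ θ in (0)..(2 * Real.pi), (a θ * Real.cos θ + b θ * Real.sin θ) * ρ θ := by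
  have hmeas : MeasurableSet (Set.Ioc (0 : ℝ) 1 ×ˢ Set.Ico (0 : ℝ) (2 * Real.pi)) :=
    measurableSet_Ioc.prod measurableSet_Ico
  have h := integral_image_eq_integral_abs_det_fderiv_smul volume hmeas
    (fun p _ => (H.hasFDerivAt_cone p).hasFDerivWithinAt) (H.injOn_cone hpos) (fun _ => (1 : ℝ))
  rw [H.supportRegion_eq hpos, measure_congr (insert_ae_eq_self 0 _)]
  rw [setIntegral_const] at h
  simp only [smul_eq_mul, mul_one, Measure.real] at h
  rw [h, intervalIntegral.integral_of_le Real.two_pi_pos.le, ← integral_Ico_eq_integral_Ioc]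
  have h01 : (1 / 2 : ℝ) = ∫ t in Set.Ioc (0 : ℝ) 1, t := by
    rw [← intervalIntegral.integral_of_le zero_le_one]; simp
  rw [h01, ← setIntegral_prod_mul]
  refine setIntegral_congr_fun hmeas fun p hp => ?_
  have h0 : 0 < p.1 * ((a p.2 * Real.cos p.2 + b p.2 * Real.sin p.2) * ρ p.2) :=
    mul_pos hp.1.1 (mul_pos (hpos _) (H.radius_pos _))
  simp only [LinearMap.det_toContinuousLinearMap, LinearMap.det_toLin, Matrix.det_fin_two_of]
  rw [← abs_of_pos h0]
  congr 1; ring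

theorem translate (H : IsNormalAngleCurve a b ρ) (x y : ℝ) :
    IsNormalAngleCurve (fun θ => a θ - x) (fun θ => b θ - y) ρ where
  hasDerivAt_fst θ := (H.hasDerivAt_fst θ).sub_const x
  hasDerivAt_snd θ := (H.hasDerivAt_snd θ).sub_const y
  continuous_radius := H.continuous_radius
  radius_pos := H.radius_pos
  periodic_fst θ := by simp only [H.periodic_fst θ]
  periodic_snd θ := by simp only [H.periodic_snd θ]

theorem dual (H : IsNormalAngleCurve a b ρ) {r : ℝ} (hr : ∀ θ, ρ θ < r) :
    IsNormalAngleCurve (fun θ => r * Real.cos θ - a θ) (fun θ => r * Real.sin θ - b θ)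
      (fun θ => r - ρ θ) where
  hasDerivAt_fst θ :=
    (((Real.hasDerivAt_cos θ).const_mul r).sub (H.hasDerivAt_fst θ)).congr_deriv (by ring)
  hasDerivAt_snd θ :=
    (((Real.hasDerivAt_sin θ).const_mul r).sub (H.hasDerivAt_snd θ)).congr_deriv (by ring)
  continuous_radius := continuous_const.sub H.continuous_radius
  radius_pos θ := sub_pos.2 (hr θ)
  periodic_fst θ := by simp only [H.periodic_fst θ, Real.cos_add_two_pi]
  periodic_snd θ := by simp only [H.periodic_snd θ, Real.sin_add_two_pi]

theorem volume_supportRegion_translate (a b : ℝ → ℝ) (x y : ℝ) :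
    volume (supportRegion (fun θ => a θ - x) (fun θ => b θ - y)) =
      volume (supportRegion a b) := by
  rw [← measure_preimage_add_right volume ((x, y) : ℝ × ℝ) (supportRegion a b)]
  congr 1
  ext p
  refine forall_congr' fun θ => ?_
  simp only [Prod.fst_add, Prod.snd_add]
  constructor <;> intro h <;> linarith

theorem exists_lt_support (H : IsNormalAngleCurve a b ρ) :
    ∃ x y : ℝ, ∀ θ, 0 < (a θ - x) * Real.cos θ + (b θ - y) * Real.sin θ := by
  refine ⟨(a 0 + a Real.pi) / 2, (b 0 + b Real.pi) / 2, fun θ' => ?_⟩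
  have hp : Function.Periodic (fun θ => (a θ - (a 0 + a Real.pi) / 2) * Real.cos θ +
      (b θ - (b 0 + b Real.pi) / 2) * Real.sin θ) (2 * Real.pi) := fun θ => by
    simp only [H.periodic_fst θ, H.periodic_snd θ, Real.cos_add_two_pi, Real.sin_add_two_pi]
  obtain ⟨θ, hθ, h⟩ := hp.exists_mem_Ico₀ Real.two_pi_pos θ'
  refine h.symm ▸ ?_
  have hpi := Real.pi_pos
  have h0 := H.height_le θ 0
  have h1 := H.height_le θ Real.pi
  rcases hθ.1.eq_or_lt with h | h
  · have := H.height_lt (θ := θ) (φ := Real.pi) ⟨by linarith, by linarith⟩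
    linarith
  · have := H.height_lt (θ := θ) (φ := 2 * Real.pi) ⟨hθ.2, by linarith⟩
    rw [H.periodic_fst.eq, H.periodic_snd.eq] at this
    linarith

theorem integral_radius_mul_sin (H : IsNormalAngleCurve a b ρ) :
    ∫ θ in (0)..(2 * Real.pi), ρ θ * Real.sin θ = 0 := by
  have hc := H.continuous_radius
  rw [intervalIntegral.integral_eq_sub_of_hasDerivAt (f := fun θ => -a θ)
    (fun θ _ => (H.hasDerivAt_fst θ).neg.congr_deriv (neg_neg _))
    (Continuous.intervalIntegrable (by fun_prop) _ _), H.periodic_fst.eq, sub_self]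

theorem integral_radius_mul_cos (H : IsNormalAngleCurve a b ρ) :
    ∫ θ in (0)..(2 * Real.pi), ρ θ * Real.cos θ = 0 := by
  have hc := H.continuous_radius
  rw [intervalIntegral.integral_eq_sub_of_hasDerivAt (fun θ _ => H.hasDerivAt_snd θ)
    (Continuous.intervalIntegrable (by fun_prop) _ _), H.periodic_snd.eq, sub_self]

/-- Cauchy's formula: the integral of the support function is the length of the curve. -/
theorem integral_support (H : IsNormalAngleCurve a b ρ) :
    ∫ θ in (0)..(2 * Real.pi), (a θ * Real.cos θ + b θ * Real.sin θ) =
      ∫ θ in (0)..(2 * Real.pi), ρ θ := by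
  have hs := H.continuous_support
  have hd : ∀ θ, HasDerivAt (fun θ => b θ * Real.cos θ - a θ * Real.sin θ)
      (ρ θ - (a θ * Real.cos θ + b θ * Real.sin θ)) θ := fun θ => by
    refine (((H.hasDerivAt_snd θ).mul (Real.hasDerivAt_cos θ)).sub
      ((H.hasDerivAt_fst θ).mul (Real.hasDerivAt_sin θ))).congr_deriv ?_
    linear_combination ρ θ * Real.sin_sq_add_cos_sq θ
  have h := intervalIntegral.integral_eq_sub_of_hasDerivAt (a := 0) (b := 2 * Real.pi)
    (fun θ _ => hd θ) ((H.continuous_radius.sub hs).intervalIntegrable _ _)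
  rw [intervalIntegral.integral_sub (H.continuous_radius.intervalIntegrable _ _)
    (hs.intervalIntegrable _ _), H.periodic_fst.eq, H.periodic_snd.eq] at h
  simp only [Real.cos_two_pi, Real.sin_two_pi, Real.cos_zero, Real.sin_zero, sub_self] at h
  linarith

theorem volume_supportRegion (H : IsNormalAngleCurve a b ρ) :
    (volume (supportRegion a b)).toReal = 1 / 2 *
      ∫ θ in (0)..(2 * Real.pi), (a θ * Real.cos θ + b θ * Real.sin θ) * ρ θ := by
  obtain ⟨x, y, hxy⟩ := H.exists_lt_support
  have ha := H.continuous_fst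
  have hb := H.continuous_snd
  have hc := H.continuous_radius
  rw [← volume_supportRegion_translate a b x y, (H.translate x y).volume_supportRegion_of_pos hxy]
  have e : ∀ θ, ((a θ - x) * Real.cos θ + (b θ - y) * Real.sin θ) * ρ θ =
      (a θ * Real.cos θ + b θ * Real.sin θ) * ρ θ -
        (x * (ρ θ * Real.cos θ) + y * (ρ θ * Real.sin θ)) := fun θ => by ring
  simp only [e]
  rw [intervalIntegral.integral_sub (Continuous.intervalIntegrable (by fun_prop) _ _)
      (Continuous.intervalIntegrable (by fun_prop) _ _),
    intervalIntegral.integral_add (Continuous.intervalIntegrable (by fun_prop) _ _)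
      (Continuous.intervalIntegrable (by fun_prop) _ _),
    intervalIntegral.integral_const_mul, intervalIntegral.integral_const_mul,
    H.integral_radius_mul_cos, H.integral_radius_mul_sin]
  ring

theorem volume_supportRegion_dual (H : IsNormalAngleCurve a b ρ) {r : ℝ} (hr : ∀ θ, ρ θ < r) :
    (volume (supportRegion (fun θ => r * Real.cos θ - a θ)
      (fun θ => r * Real.sin θ - b θ))).toReal =
    (volume (supportRegion a b)).toReal - r * (∫ θ in (0)..(2 * Real.pi), ρ θ) +
      Real.pi * r ^ 2 := by
  have ha := H.continuous_fst
  have hb := H.continuous_snd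
  have hc := H.continuous_radius
  rw [(H.dual hr).volume_supportRegion, H.volume_supportRegion]
  have e : ∀ θ, ((r * Real.cos θ - a θ) * Real.cos θ + (r * Real.sin θ - b θ) * Real.sin θ) *
      (r - ρ θ) = (r ^ 2 - r * ρ θ) - (r * (a θ * Real.cos θ + b θ * Real.sin θ) -
        (a θ * Real.cos θ + b θ * Real.sin θ) * ρ θ) := fun θ => by
    linear_combination r * (r - ρ θ) * Real.sin_sq_add_cos_sq θ
  simp only [e]
  rw [intervalIntegral.integral_sub (Continuous.intervalIntegrable (by fun_prop) _ _)
      (Continuous.intervalIntegrable (by fun_prop) _ _),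
    intervalIntegral.integral_sub (Continuous.intervalIntegrable (by fun_prop) _ _)
      (Continuous.intervalIntegrable (by fun_prop) _ _),
    intervalIntegral.integral_sub (Continuous.intervalIntegrable (by fun_prop) _ _)
      (Continuous.intervalIntegrable (by fun_prop) _ _),
    intervalIntegral.integral_const_mul, intervalIntegral.integral_const_mul,
    H.integral_support, intervalIntegral.integral_const]
  simp only [smul_eq_mul]
  ring

theorem continuous_curve (H : IsNormalAngleCurve a b ρ) :
    Continuous (fun θ => (!₂[a θ, b θ] : EuclideanSpace ℝ (Fin 2))) := by
  have ha := H.continuous_fst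
  have hb := H.continuous_snd
  refine (PiLp.continuous_toLp 2 _).comp (continuous_pi fun i => ?_)
  fin_cases i
  exacts [ha, hb]

theorem injOn_curve (H : IsNormalAngleCurve a b ρ) :
    Set.InjOn (fun θ => (!₂[a θ, b θ] : EuclideanSpace ℝ (Fin 2)))
      (Set.Ico 0 (2 * Real.pi)) := fun θ hθ φ hφ h => by
  have h0 := congrArg (fun v : EuclideanSpace ℝ (Fin 2) => v 0) h
  have h1 := congrArg (fun v : EuclideanSpace ℝ (Fin 2) => v 1) h
  exact H.injOn hθ hφ (Prod.ext (by simpa using h0) (by simpa using h1))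

/-- A short arc is at least as long as its projection to the tangent line at an endpoint. -/
theorem le_hausdorffMeasure_arc (H : IsNormalAngleCurve a b ρ) (α : ℝ) {δ : ℝ} (hδ : 0 ≤ δ)
    (hδ' : δ ≤ Real.pi) :
    ENNReal.ofReal (Real.cos δ * ∫ θ in α..(α + δ), ρ θ) ≤
      μH[1] ((fun θ => (!₂[a θ, b θ] : EuclideanSpace ℝ (Fin 2))) '' Set.Ico α (α + δ)) := by
  set u : EuclideanSpace ℝ (Fin 2) := !₂[-Real.sin α, Real.cos α] with hu
  have hun : ‖u‖ = 1 := by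
    rw [EuclideanSpace.norm_eq]; simp [hu]
  set f : ℝ → ℝ := fun θ => a θ * -Real.sin α + b θ * Real.cos α with hf
  have hfd : ∀ θ, HasDerivAt f (ρ θ * Real.cos (θ - α)) θ := fun θ => by
    refine (((H.hasDerivAt_fst θ).mul_const _).add
      ((H.hasDerivAt_snd θ).mul_const _)).congr_deriv ?_
    rw [Real.cos_sub]; ring
  have hfc : Continuous f := continuous_iff_continuousAt.2 fun θ => (hfd θ).continuousAt
  have hc := H.continuous_radius
  have hlip : LipschitzWith 1 (fun v => inner ℝ u v) := by
    refine LipschitzWith.of_dist_le_mul fun v w => ?_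
    rw [Real.dist_eq, ← inner_sub_right, dist_eq_norm]
    simpa [hun] using abs_real_inner_le_norm u (v - w)
  have hle : Real.cos δ * ∫ θ in α..(α + δ), ρ θ ≤ f (α + δ) - f α := by
    rw [← intervalIntegral.integral_eq_sub_of_hasDerivAt (fun θ _ => hfd θ)
      (Continuous.intervalIntegrable (by fun_prop) _ _), ← intervalIntegral.integral_const_mul]
    refine intervalIntegral.integral_mono_on (by linarith)
      (Continuous.intervalIntegrable (by fun_prop) _ _)
      (Continuous.intervalIntegrable (by fun_prop) _ _) fun θ hθ => ?_
    rw [mul_comm]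
    refine mul_le_mul_of_nonneg_left ?_ (H.radius_pos θ).le
    exact Real.cos_le_cos_of_nonneg_of_le_pi (by linarith [hθ.1]) hδ' (by linarith [hθ.2])
  calc ENNReal.ofReal (Real.cos δ * ∫ θ in α..(α + δ), ρ θ)
      ≤ ENNReal.ofReal (f (α + δ) - f α) := ENNReal.ofReal_le_ofReal hle
    _ = μH[1] (Set.Ico (f α) (f (α + δ))) := by rw [hausdorffMeasure_real, Real.volume_Ico]
    _ ≤ μH[1] (f '' Set.Ico α (α + δ)) :=
        measure_mono (intermediate_value_Ico (by linarith) hfc.continuousOn)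
    _ = μH[1] ((fun v => inner ℝ u v) ''
          ((fun θ => (!₂[a θ, b θ] : EuclideanSpace ℝ (Fin 2))) '' Set.Ico α (α + δ))) := by
        rw [Set.image_image]
        congr 2
        ext θ
        simp [hf, hu, PiLp.inner_apply]
    _ ≤ _ := by simpa using hlip.hausdorffMeasure_image_le zero_le_one _

theorem le_hausdorffMeasure (H : IsNormalAngleCurve a b ρ) :
    ENNReal.ofReal (∫ θ in (0)..(2 * Real.pi), ρ θ) ≤
      μH[1] ((fun θ => (!₂[a θ, b θ] : EuclideanSpace ℝ (Fin 2))) ''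
        Set.Ico 0 (2 * Real.pi)) := by
  set c := fun θ => (!₂[a θ, b θ] : EuclideanSpace ℝ (Fin 2)) with hc
  have hρ := H.continuous_radius
  have hpos := Real.two_pi_pos
  have main : ∀ δ : ℝ, 0 ≤ δ → δ ≤ Real.pi / 2 → ∀ n : ℕ, n * δ ≤ 2 * Real.pi →
      ENNReal.ofReal (Real.cos δ * ∫ θ in (0)..(n * δ), ρ θ) ≤
        μH[1] (c '' Set.Ico 0 (n * δ)) := by
    intro δ hδ hδ' n
    have hcos : 0 ≤ Real.cos δ := Real.cos_nonneg_of_neg_pi_div_two_le_of_le (by linarith) hδ'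
    induction n with
    | zero => simp
    | succ n ih =>
      intro hn
      push_cast at hn ⊢
      rw [add_mul, one_mul] at hn ⊢
      have hnδ : 0 ≤ n * δ := by positivity
      have hsub1 : Set.Ico 0 (n * δ) ⊆ Set.Ico 0 (2 * Real.pi) :=
        Set.Ico_subset_Ico_right (by linarith)
      have hsub2 : Set.Ico (n * δ) (n * δ + δ) ⊆ Set.Ico 0 (2 * Real.pi) :=
        Set.Ico_subset_Ico hnδ hn
      rw [← intervalIntegral.integral_add_adjacent_intervals (b := n * δ)
        (hρ.intervalIntegrable _ _) (hρ.intervalIntegrable _ _), mul_add,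
        ← Set.Ico_union_Ico_eq_Ico hnδ (le_add_of_nonneg_right hδ), Set.image_union,
        measure_union]
      · exact ENNReal.ofReal_add_le.trans (add_le_add (ih (by linarith))
          (H.le_hausdorffMeasure_arc _ hδ (by linarith)))
      · exact Set.Ico_disjoint_Ico_same.image H.injOn_curve hsub1 hsub2
      · exact measurableSet_Ico.image_of_continuousOn_injOn H.continuous_curve.continuousOn
          (H.injOn_curve.mono hsub2)
  have hlim : Filter.Tendsto (fun n : ℕ => ENNReal.ofReal (Real.cos (2 * Real.pi / n) *
      ∫ θ in (0)..(2 * Real.pi), ρ θ)) Filter.atTop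
      (nhds (ENNReal.ofReal (∫ θ in (0)..(2 * Real.pi), ρ θ))) := by
    refine ENNReal.tendsto_ofReal ?_
    have h := (Real.continuous_cos.tendsto 0).comp
      (tendsto_const_div_atTop_nhds_zero_nat (2 * Real.pi))
    simpa using h.mul_const (∫ θ in (0)..(2 * Real.pi), ρ θ)
  refine le_of_tendsto hlim ?_
  filter_upwards [Filter.eventually_ge_atTop 4] with n hn
  have hn' : (4 : ℝ) ≤ n := by exact_mod_cast hn
  have hne : (n : ℝ) * (2 * Real.pi / n) = 2 * Real.pi := by field_simp
  have h := main (2 * Real.pi / n) (by positivity)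
    (by rw [div_le_iff₀ (by linarith)]; nlinarith [Real.pi_pos]) n hne.le
  rwa [hne] at h

end IsNormalAngleCurve

theorem exists_polar_angle (x y : ℝ) :
    ∃ θ, x = √(x ^ 2 + y ^ 2) * Real.cos θ ∧ y = √(x ^ 2 + y ^ 2) * Real.sin θ := by
  have hn : ‖(⟨x, y⟩ : ℂ)‖ = √(x ^ 2 + y ^ 2) := by
    rw [Complex.norm_def, Complex.normSq_mk, sq, sq]
  refine ⟨Complex.arg ⟨x, y⟩, ?_, ?_⟩
  · rw [← hn, Complex.norm_mul_cos_arg]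
  · rw [← hn, Complex.norm_mul_sin_arg]

theorem hasDerivAt_euclidean_apply {f : ℝ → EuclideanSpace ℝ (Fin 2)}
    {f' : EuclideanSpace ℝ (Fin 2)} {s : ℝ} (h : HasDerivAt f f' s) (i : Fin 2) :
    HasDerivAt (fun s => f s i) (f' i) s :=
  (EuclideanSpace.proj (𝕜 := ℝ) i).hasFDerivAt.comp_hasDerivAt s h

section UnitSpeed

variable {γ : ℝ → EuclideanSpace ℝ (Fin 2)} {κ : ℝ → ℝ}

theorem unitSpeed_sq (hγspeed : ∀ s, ‖deriv γ s‖ = 1) (s : ℝ) :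
    deriv γ s 0 ^ 2 + deriv γ s 1 ^ 2 = 1 := by
  have h := EuclideanSpace.real_norm_sq_eq (deriv γ s)
  rw [hγspeed, Fin.sum_univ_two] at h
  linarith

theorem continuous_curvature (hγ : ContDiff ℝ 2 γ)
    (hκdef : ∀ s, κ s =
      deriv γ s 0 * deriv (deriv γ) s 1 - deriv γ s 1 * deriv (deriv γ) s 0) :
    Continuous κ := by
  have h1 : ContDiff ℝ 1 (deriv γ) := ContDiff.deriv' (n := 1) hγ
  have h2 : Continuous (deriv (deriv γ)) := h1.continuous_deriv le_rfl
  have h3 := h1.continuous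
  rw [funext hκdef]
  have happ : ∀ {f : ℝ → EuclideanSpace ℝ (Fin 2)}, Continuous f → ∀ i,
      Continuous fun s => f s i := fun hf i => (EuclideanSpace.proj (𝕜 := ℝ) i).continuous.comp hf
  exact ((happ h3 0).mul (happ h2 1)).sub ((happ h3 1).mul (happ h2 0))

/-- The angle of the outer normal along a unit speed curve is an antiderivative of the
curvature. -/
theorem exists_normal_angle (hγ : ContDiff ℝ 2 γ) (hγspeed : ∀ s, ‖deriv γ s‖ = 1)
    (hκdef : ∀ s, κ s =
      deriv γ s 0 * deriv (deriv γ) s 1 - deriv γ s 1 * deriv (deriv γ) s 0) :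
    ∃ Θ : ℝ → ℝ, ∀ s, HasDerivAt Θ (κ s) s ∧
      deriv γ s 0 = -Real.sin (Θ s) ∧ deriv γ s 1 = Real.cos (Θ s) := by
  have hκc := continuous_curvature hγ hκdef
  have hsq := unitSpeed_sq hγspeed
  have h1 : ContDiff ℝ 1 (deriv γ) := ContDiff.deriv' (n := 1) hγ
  have hd : ∀ s i, HasDerivAt (fun s => deriv γ s i) (deriv (deriv γ) s i) s := fun s i =>
    hasDerivAt_euclidean_apply ((h1.differentiable one_ne_zero s).hasDerivAt) i
  have horth : ∀ s, deriv γ s 0 * deriv (deriv γ) s 0 + deriv γ s 1 * deriv (deriv γ) s 1 = 0 := by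
    intro s
    have h := ((hd s 0).pow 2).add ((hd s 1).pow 2)
    have hc : HasDerivAt (fun s => deriv γ s 0 ^ 2 + deriv γ s 1 ^ 2) 0 s := by
      rw [funext hsq]; exact hasDerivAt_const _ _
    have := h.unique hc
    norm_num at this
    linarith
  have hp : ∀ s, deriv (deriv γ) s 0 = -(κ s * deriv γ s 1) := fun s => by
    rw [hκdef]
    linear_combination deriv γ s 0 * horth s - deriv (deriv γ) s 0 * hsq s
  have hq : ∀ s, deriv (deriv γ) s 1 = κ s * deriv γ s 0 := fun s => by
    rw [hκdef]
    linear_combination deriv γ s 1 * horth s - deriv (deriv γ) s 1 * hsq s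
  obtain ⟨θ₀, hc0, hs0⟩ := exists_polar_angle (deriv γ 0 1) (-deriv γ 0 0)
  rw [neg_sq, add_comm, hsq 0, Real.sqrt_one, one_mul] at hc0 hs0
  set Θ : ℝ → ℝ := fun s => θ₀ + ∫ t in (0)..s, κ t with hΘ
  have hΘd : ∀ s, HasDerivAt Θ (κ s) s := fun s =>
    (intervalIntegral.integral_hasDerivAt_right (hκc.intervalIntegrable _ _)
      (hκc.stronglyMeasurableAtFilter _ _) hκc.continuousAt).const_add _
  have hwd : ∀ s, HasDerivAt
      (fun s => deriv γ s 1 * Real.cos (Θ s) - deriv γ s 0 * Real.sin (Θ s)) 0 s := fun s => by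
    refine (((hd s 1).mul (hΘd s).cos).sub ((hd s 0).mul (hΘd s).sin)).congr_deriv ?_
    rw [hp, hq]; ring
  have hw : ∀ s, deriv γ s 1 * Real.cos (Θ s) - deriv γ s 0 * Real.sin (Θ s) = 1 := fun s => by
    have h := is_const_of_deriv_eq_zero (fun s => (hwd s).differentiableAt)
      (fun s => (hwd s).deriv) s 0
    have h0 : Θ 0 = θ₀ := by simp [hΘ]
    simp only [h0, ← hc0, ← hs0] at h
    rw [h]
    linarith [hsq 0]
  refine ⟨Θ, fun s => ⟨hΘd s, ?_⟩⟩
  have hz : (deriv γ s 0 + Real.sin (Θ s)) ^ 2 + (deriv γ s 1 - Real.cos (Θ s)) ^ 2 = 0 := by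
    linear_combination hsq s - 2 * hw s + Real.sin_sq_add_cos_sq (Θ s)
  constructor
  · have : deriv γ s 0 + Real.sin (Θ s) = 0 := by nlinarith
    linarith
  · have : deriv γ s 1 - Real.cos (Θ s) = 0 := by nlinarith
    linarith

/-- A unit speed curve with curvature bounded below by a positive constant can be reparametrized
by the angle of its outer normal. -/
theorem exists_normalAngle_parametrization (hγ : ContDiff ℝ 2 γ)
    (hγspeed : ∀ s, ‖deriv γ s‖ = 1)
    (hκdef : ∀ s, κ s =
      deriv γ s 0 * deriv (deriv γ) s 1 - deriv γ s 1 * deriv (deriv γ) s 0)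
    {κm : ℝ} (hκm : 0 < κm) (hκ : ∀ s, κm ≤ κ s) :
    ∃ σ ρ : ℝ → ℝ, Function.Surjective σ ∧ Monotone σ ∧ (∀ θ, HasDerivAt σ (ρ θ) θ) ∧
      (∀ θ, ρ θ ≤ 1 / κm) ∧
      IsNormalAngleArc (fun θ => γ (σ θ) 0) (fun θ => γ (σ θ) 1) ρ := by
  have hκc := continuous_curvature hγ hκdef
  obtain ⟨Θ, hΘ⟩ := exists_normal_angle hγ hγspeed hκdef
  have hκpos : ∀ s, 0 < κ s := fun s => hκm.trans_le (hκ s)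
  have hmono : StrictMono Θ :=
    strictMono_of_deriv_pos fun s => (hΘ s).1.deriv.symm ▸ hκpos s
  have hΘc : Continuous Θ := continuous_iff_continuousAt.2 fun s => (hΘ s).1.continuousAt
  have hgrow : Monotone fun s => Θ s - κm * s :=
    monotone_of_deriv_nonneg
      (fun s => ((hΘ s).1.sub ((hasDerivAt_id s).const_mul κm)).differentiableAt) fun s => by
        have h := ((hΘ s).1.sub ((hasDerivAt_id s).const_mul κm)).deriv
        rw [mul_one] at h
        exact h.symm ▸ sub_nonneg.2 (hκ s)
  have hsurj : Function.Surjective Θ := by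
    refine hΘc.surjective ?_ ?_
    · refine Filter.tendsto_atTop_mono' _ ?_ (Filter.tendsto_atTop_add_const_left _ (Θ 0)
        (Filter.tendsto_id.const_mul_atTop hκm))
      filter_upwards [Filter.eventually_ge_atTop 0] with s hs
      have := hgrow hs
      simp only [id] at this ⊢
      linarith
    · refine Filter.tendsto_atBot_mono' _ ?_ (Filter.tendsto_atBot_add_const_left _ (Θ 0)
        (Filter.tendsto_id.const_mul_atBot hκm))
      filter_upwards [Filter.eventually_le_atBot 0] with s hs
      have := hgrow hs
      simp only [id] at this ⊢
      linarith
  set e := hmono.orderIsoOfSurjective Θ hsurj with he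
  have hΘσ : ∀ θ, Θ (e.symm θ) = θ := fun θ => e.apply_symm_apply θ
  have hσ : ∀ θ, HasDerivAt e.symm (κ (e.symm θ))⁻¹ θ := fun θ =>
    HasDerivAt.of_local_left_inverse e.symm.continuous.continuousAt (hΘ _).1 (hκpos _).ne'
      (Filter.Eventually.of_forall hΘσ)
  have hγd : ∀ θ i, HasDerivAt (fun θ => γ (e.symm θ) i)
      (deriv γ (e.symm θ) i * (κ (e.symm θ))⁻¹) θ := fun θ i =>
    (hasDerivAt_euclidean_apply
      ((hγ.differentiable two_ne_zero (e.symm θ)).hasDerivAt) i).comp θ (hσ θ)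
  refine ⟨e.symm, fun θ => (κ (e.symm θ))⁻¹, e.symm.surjective, e.symm.monotone, hσ, fun θ => ?_,
    fun θ => ?_, fun θ => ?_, ?_, fun θ => inv_pos.2 (hκpos _)⟩
  · simpa only [one_div] using one_div_le_one_div_of_le hκm (hκ _)
  · refine (hγd θ 0).congr_deriv ?_
    rw [(hΘ _).2.1, hΘσ]; ring
  · refine (hγd θ 1).congr_deriv ?_
    rw [(hΘ _).2.2, hΘσ]; ring
  · exact (hκc.comp e.symm.continuous).inv₀ fun θ => (hκpos _).ne'

end UnitSpeed

theorem continuousLinearMap_euclidean_apply (f : EuclideanSpace ℝ (Fin 2) →L[ℝ] ℝ)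
    (v : EuclideanSpace ℝ (Fin 2)) :
    f v = f (EuclideanSpace.single 0 1) * v 0 + f (EuclideanSpace.single 1 1) * v 1 := by
  have hv : v = v 0 • EuclideanSpace.single 0 (1 : ℝ) + v 1 • EuclideanSpace.single 1 (1 : ℝ) := by
    ext i; fin_cases i <;> simp
  conv_lhs => rw [hv]
  rw [map_add, map_smul, map_smul, smul_eq_mul, smul_eq_mul]
  ring

namespace IsNormalAngleArc

variable {a b ρ : ℝ → ℝ} {K : Set (EuclideanSpace ℝ (Fin 2))}

/-- The normal line of a boundary arc is the outer normal of a supporting half-plane. -/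
theorem support_le (H : IsNormalAngleArc a b ρ) (hKclosed : IsClosed K) (hKconv : Convex ℝ K)
    (hKint : (interior K).Nonempty) (hab : ∀ θ, !₂[a θ, b θ] ∈ frontier K) (θ : ℝ)
    {y : EuclideanSpace ℝ (Fin 2)} (hy : y ∈ K) :
    y 0 * Real.cos θ + y 1 * Real.sin θ ≤ a θ * Real.cos θ + b θ * Real.sin θ := by
  obtain ⟨f, hf⟩ := geometric_hahn_banach_open_point hKconv.interior isOpen_interior (hab θ).2
  have hfK : ∀ y ∈ K, f y ≤ f !₂[a θ, b θ] := by
    intro y hy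
    have hcl : K ⊆ closure (interior K) := by
      rw [hKconv.closure_interior_eq_closure_of_nonempty_interior hKint]
      exact subset_closure
    exact closure_minimal (fun z hz => (hf z hz).le)
      (isClosed_le f.continuous continuous_const) (hcl hy)
  obtain ⟨z, hz⟩ := hKint
  have hfz := hf z hz
  set m := f (EuclideanSpace.single 0 1)
  set n := f (EuclideanSpace.single 1 1)
  have hfe : ∀ v, f v = m * v 0 + n * v 1 := continuousLinearMap_euclidean_apply f
  have hfx : ∀ φ, f !₂[a φ, b φ] = m * a φ + n * b φ := fun φ => by
    rw [hfe]; simp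
  have hmax : ∀ φ, m * a φ + n * b φ ≤ m * a θ + n * b θ := fun φ => by
    have := hfK _ (hKclosed.frontier_subset (hab φ))
    rwa [hfx, hfx] at this
  have hd := ((H.hasDerivAt_fst θ).const_mul m).add ((H.hasDerivAt_snd θ).const_mul n)
  have h0 := IsLocalMax.hasDerivAt_eq_zero
    (Filter.Eventually.of_forall hmax : IsLocalMax (fun φ => m * a φ + n * b φ) θ) hd
  have h1 : -m * Real.sin θ + n * Real.cos θ = 0 := by
    refine (mul_eq_zero.1 ?_).resolve_left (H.radius_pos θ).ne'
    linear_combination h0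
  set c := m * Real.cos θ + n * Real.sin θ with hc
  have hcs := Real.sin_sq_add_cos_sq θ
  have hm : m = c * Real.cos θ := by
    linear_combination Real.cos θ * hc - m * hcs + (-Real.sin θ) * h1
  have hn : n = c * Real.sin θ := by
    linear_combination Real.sin θ * hc - n * hcs + Real.cos θ * h1
  have hcv : ∀ x y, m * x + n * y = c * (x * Real.cos θ + y * Real.sin θ) := fun x y => by
    linear_combination x * hm + y * hn
  have hcpos : 0 < c := by
    rcases lt_trichotomy c 0 with hneg | hzero | hpos
    · have hpi := Real.pi_pos
      have h2 := hmax (θ + Real.pi)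
      rw [hcv, hcv] at h2
      have h3 := H.strictAntiOn_height θ ⟨le_rfl, by linarith⟩ ⟨by linarith, le_rfl⟩
        (show θ < θ + Real.pi by linarith)
      simp only at h3
      nlinarith
    · rw [hfx, hfe, hcv, hcv, hzero] at hfz
      simp at hfz
    · exact hpos
  have h := hfK y hy
  rw [hfx, hfe, hcv, hcv] at h
  exact le_of_mul_le_mul_left h hcpos

theorem isNormalAngleCurve (H : IsNormalAngleArc a b ρ)
    (h : ∀ θ φ, a φ * Real.cos θ + b φ * Real.sin θ ≤ a θ * Real.cos θ + b θ * Real.sin θ) :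
    IsNormalAngleCurve a b ρ := by
  have h0 : ∀ θ, (a (θ + 2 * Real.pi) - a θ) * Real.cos θ +
      (b (θ + 2 * Real.pi) - b θ) * Real.sin θ = 0 := fun θ => by
    have h1 := h θ (θ + 2 * Real.pi)
    have h2 := h (θ + 2 * Real.pi) θ
    rw [Real.cos_add_two_pi, Real.sin_add_two_pi] at h2
    linarith
  have h1 : ∀ θ, -(a (θ + 2 * Real.pi) - a θ) * Real.sin θ +
      (b (θ + 2 * Real.pi) - b θ) * Real.cos θ = 0 := fun θ => by
    have hd := ((((H.hasDerivAt_fst (θ + 2 * Real.pi)).comp_add_const θ (2 * Real.pi)).sub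
      (H.hasDerivAt_fst θ)).mul (Real.hasDerivAt_cos θ)).add
      ((((H.hasDerivAt_snd (θ + 2 * Real.pi)).comp_add_const θ (2 * Real.pi)).sub
      (H.hasDerivAt_snd θ)).mul (Real.hasDerivAt_sin θ))
    have hc : HasDerivAt (fun θ => (a (θ + 2 * Real.pi) - a θ) * Real.cos θ +
      (b (θ + 2 * Real.pi) - b θ) * Real.sin θ) 0 θ := by
      rw [funext h0]; exact hasDerivAt_const _ _
    have := hd.unique hc
    simp only [Real.cos_add_two_pi, Real.sin_add_two_pi, Pi.sub_apply] at this
    linear_combination this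
  refine ⟨H, fun θ => ?_, fun θ => ?_⟩
  · linear_combination Real.cos θ * h0 θ - Real.sin θ * h1 θ -
      (a (θ + 2 * Real.pi) - a θ) * Real.sin_sq_add_cos_sq θ
  · linear_combination Real.sin θ * h0 θ + Real.cos θ * h1 θ -
      (b (θ + 2 * Real.pi) - b θ) * Real.sin_sq_add_cos_sq θ

end IsNormalAngleArc

theorem measurePreserving_euclidean_coords :
    MeasurePreserving (fun v : EuclideanSpace ℝ (Fin 2) => (v 0, v 1)) :=
  (volume_preserving_finTwoArrow ℝ).comp
    (EuclideanSpace.volume_preserving_symm_measurableEquiv_toLp (Fin 2))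

theorem measurableSet_supportRegion (a b : ℝ → ℝ) : MeasurableSet (supportRegion a b) := by
  refine IsClosed.measurableSet ?_
  rw [supportRegion, Set.ofPred_forall]
  exact isClosed_iInter fun θ => isClosed_le (by fun_prop) continuous_const

/-- A closed convex set is the intersection of the half-planes that support it. -/
theorem eq_preimage_supportRegion {K : Set (EuclideanSpace ℝ (Fin 2))} {a b : ℝ → ℝ}
    (hKclosed : IsClosed K) (hKconv : Convex ℝ K) (hab : ∀ θ, !₂[a θ, b θ] ∈ K)
    (hsupp : ∀ θ, ∀ y ∈ K,
      y 0 * Real.cos θ + y 1 * Real.sin θ ≤ a θ * Real.cos θ + b θ * Real.sin θ) :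
    K = (fun v : EuclideanSpace ℝ (Fin 2) => (v 0, v 1)) ⁻¹' supportRegion a b := by
  refine Set.Subset.antisymm (fun y hy θ => hsupp θ y hy) fun y hy => ?_
  by_contra hyK
  obtain ⟨f, u, hfK, hfy⟩ := geometric_hahn_banach_closed_point hKconv hKclosed hyK
  have hf := continuousLinearMap_euclidean_apply f
  set m := f (EuclideanSpace.single 0 1)
  set n := f (EuclideanSpace.single 1 1)
  obtain ⟨θ, hm, hn⟩ := exists_polar_angle m n
  have hR := Real.sqrt_nonneg (m ^ 2 + n ^ 2)
  set R := √(m ^ 2 + n ^ 2)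
  have h1 : m * a θ + n * b θ < m * y 0 + n * y 1 := by
    simpa [hf] using (hfK _ (hab θ)).trans hfy
  have h2 := mul_le_mul_of_nonneg_left (hy θ) hR
  simp only at h2
  rw [hm, hn] at h1
  linarith

theorem setOf_subset_closedBall_eq {K : Set (EuclideanSpace ℝ (Fin 2))} {a b : ℝ → ℝ}
    (hab : ∀ θ, !₂[a θ, b θ] ∈ K)
    (hsupp : ∀ θ, ∀ y ∈ K,
      y 0 * Real.cos θ + y 1 * Real.sin θ ≤ a θ * Real.cos θ + b θ * Real.sin θ) (r : ℝ) :
    {x | K ⊆ closedBall x r} = (fun v : EuclideanSpace ℝ (Fin 2) => (v 0, v 1)) ⁻¹'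
      (Neg.neg ⁻¹' supportRegion (fun θ => r * Real.cos θ - a θ)
        (fun θ => r * Real.sin θ - b θ)) := by
  have hnorm : ∀ v : EuclideanSpace ℝ (Fin 2), ‖v‖ = √(v 0 ^ 2 + v 1 ^ 2) := fun v => by
    rw [EuclideanSpace.norm_eq]; simp
  ext x
  constructor
  · intro hx θ
    have h := hx (hab θ)
    rw [mem_closedBall, dist_eq_norm, hnorm] at h
    have hcs := Real.sin_sq_add_cos_sq θ
    have h2 : (a θ - x 0) * Real.cos θ + (b θ - x 1) * Real.sin θ ≤ r := by
      refine le_trans (Real.le_sqrt_of_sq_le ?_) h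
      simp
      nlinarith [sq_nonneg ((a θ - x 0) * Real.sin θ - (b θ - x 1) * Real.cos θ)]
    simp only [Prod.neg_mk]
    linear_combination h2 - r * hcs
  · intro hx y hy
    rw [mem_closedBall, dist_eq_norm, hnorm]
    obtain ⟨θ, hm, hn⟩ := exists_polar_angle ((y - x) 0) ((y - x) 1)
    set R := √((y - x) 0 ^ 2 + (y - x) 1 ^ 2)
    have h1 := hx θ
    have h2 := hsupp θ y hy
    have hcs := Real.sin_sq_add_cos_sq θ
    simp only [Prod.neg_mk] at h1
    simp only [PiLp.sub_apply] at hm hn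
    have hR : R = (y 0 - x 0) * Real.cos θ + (y 1 - x 1) * Real.sin θ := by
      rw [hm, hn]; linear_combination -R * hcs
    rw [hR]
    linear_combination h1 + h2 + r * hcs

/-- For a planar convex body `K` with `C²` boundary of curvature `κ ≥ κₘ > 0` and
`r > 1/κₘ`, the area of the `r`-dual `K^{*,r} = {x : K ⊆ rB² + x}` satisfies
`A(K^{*,r}) = A(K) - r·Per(K) + πr²`, where `Per(K)` is the one-dimensional Hausdorff
measure of `∂K`. -/
theorem area_of_r_dual
    (K : Set (EuclideanSpace ℝ (Fin 2)))
    (hKcomp : IsCompact K) (hKconv : Convex ℝ K) (hKint : (interior K).Nonempty)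
    (γ : ℝ → EuclideanSpace ℝ (Fin 2)) (hγ : ContDiff ℝ 2 γ)
    (hγspeed : ∀ s, ‖deriv γ s‖ = 1)
    (hγrange : frontier K = Set.range γ)
    (κ : ℝ → ℝ)
    (hκdef : ∀ s, κ s =
      deriv γ s 0 * deriv (deriv γ) s 1 - deriv γ s 1 * deriv (deriv γ) s 0)
    (κm : ℝ) (hκm : 0 < κm) (hκ : ∀ s, κm ≤ κ s)
    (r : ℝ) (hr : 1 / κm < r) :
    (volume {x | K ⊆ closedBall x r}).toReal =
      (volume K).toReal - r * (μH[1] (frontier K)).toReal + Real.pi * r ^ 2 := by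
  obtain ⟨σ, ρ, hσsurj, hσmono, hσd, hρle, H₀⟩ :=
    exists_normalAngle_parametrization hγ hγspeed hκdef hκm hκ
  set a := fun θ => γ (σ θ) 0 with ha
  set b := fun θ => γ (σ θ) 1 with hb
  have hcurve : ∀ θ, !₂[a θ, b θ] = γ (σ θ) := fun θ => by
    ext i; fin_cases i <;> simp [ha, hb]
  have hfr : ∀ θ, !₂[a θ, b θ] ∈ frontier K := fun θ => by
    rw [hcurve, hγrange]; exact Set.mem_range_self _
  have habK : ∀ θ, !₂[a θ, b θ] ∈ K := fun θ => hKcomp.isClosed.frontier_subset (hfr θ)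
  have hsupp : ∀ θ, ∀ y ∈ K,
      y 0 * Real.cos θ + y 1 * Real.sin θ ≤ a θ * Real.cos θ + b θ * Real.sin θ :=
    fun θ y hy => H₀.support_le hKcomp.isClosed hKconv hKint hfr θ hy
  have H : IsNormalAngleCurve a b ρ :=
    H₀.isNormalAngleCurve fun θ φ => by simpa using hsupp θ _ (habK φ)
  have hlength : ∫ θ in (0)..(2 * Real.pi), ρ θ = σ (2 * Real.pi) - σ 0 :=
    intervalIntegral.integral_eq_sub_of_hasDerivAt (fun θ _ => hσd θ)
      (H.continuous_radius.intervalIntegrable _ _)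
  have himage : frontier K = (fun θ => (!₂[a θ, b θ] : EuclideanSpace ℝ (Fin 2))) ''
      Set.Ico 0 (2 * Real.pi) := by
    refine Set.Subset.antisymm ?_ (Set.image_subset_iff.2 fun θ _ => hfr θ)
    rw [hγrange]
    rintro _ ⟨s, rfl⟩
    obtain ⟨θ, rfl⟩ := hσsurj s
    have hp : Function.Periodic (fun θ => (!₂[a θ, b θ] : EuclideanSpace ℝ (Fin 2)))
        (2 * Real.pi) := fun θ => by simp only [H.periodic_fst θ, H.periodic_snd θ]
    obtain ⟨φ, hφ, h⟩ := hp.exists_mem_Ico₀ Real.two_pi_pos θ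
    exact ⟨φ, hφ, h.symm.trans (hcurve θ)⟩
  have hlip : LipschitzWith 1 γ :=
    lipschitzWith_of_nnnorm_deriv_le (hγ.differentiable two_ne_zero) fun s => by
      rw [← NNReal.coe_le_coe, coe_nnnorm, hγspeed, NNReal.coe_one]
  have hupper : μH[1] (frontier K) ≤ ENNReal.ofReal (∫ θ in (0)..(2 * Real.pi), ρ θ) := by
    calc μH[1] (frontier K) ≤ μH[1] (γ '' Set.Icc (σ 0) (σ (2 * Real.pi))) := by
          refine measure_mono ?_
          rw [himage]
          rintro _ ⟨θ, hθ, rfl⟩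
          exact ⟨σ θ, ⟨hσmono hθ.1, hσmono hθ.2.le⟩, (hcurve θ).symm⟩
      _ ≤ μH[1] (Set.Icc (σ 0) (σ (2 * Real.pi))) := by
          simpa only [ENNReal.coe_one, ENNReal.one_rpow, one_mul] using
            hlip.hausdorffMeasure_image_le zero_le_one _
      _ = _ := by rw [hausdorffMeasure_real, Real.volume_Icc, hlength]
  have hper : (μH[1] (frontier K)).toReal = ∫ θ in (0)..(2 * Real.pi), ρ θ := by
    rw [le_antisymm hupper (himage ▸ H.le_hausdorffMeasure), ENNReal.toReal_ofReal]
    rw [hlength]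
    exact sub_nonneg.2 (hσmono Real.two_pi_pos.le)
  have hK : volume K = volume (supportRegion a b) := by
    conv_lhs => rw [eq_preimage_supportRegion hKcomp.isClosed hKconv habK hsupp]
    exact measurePreserving_euclidean_coords.measure_preimage
      (measurableSet_supportRegion a b).nullMeasurableSet
  have hdual : volume {x | K ⊆ closedBall x r} = volume (supportRegion
      (fun θ => r * Real.cos θ - a θ) (fun θ => r * Real.sin θ - b θ)) := by
    rw [setOf_subset_closedBall_eq habK hsupp, measurePreserving_euclidean_coords.measure_preimage
      ((measurableSet_supportRegion _ _).preimage measurable_neg).nullMeasurableSet,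
      Measure.measure_preimage_neg]
  rw [hdual, hK, hper, H.volume_supportRegion_dual fun θ => (hρle θ).trans_lt hr]
end

section
/- Let K ⊂ ℝ² be a convex body of constant width r with C² boundary of strictly positive curvature. Then for every real number p, ∫_{∂K} (κ(x) − 1/r)^p dx = r^{1−2p} · ∫_{∂K} (κ(x) − 1/r)^{1−p} dx, where integration is with respect to arc length and κ(x) > 1/r is the curvature at x. -/
open Metric

section BallHull

variable {X : Type*} [PseudoMetricSpace X]

/-- A frontier point of a compact set `K` which contains every centre of a closed ball of radius
`r` around `K` lies at distance at least `r` from some point of `K`. -/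
lemma exists_mem_le_dist_of_mem_frontier {K : Set X} (hK : IsCompact K) (hKc : IsClosed K) {r : ℝ}
    (hsub : {x | K ⊆ closedBall x r} ⊆ K) {x : X} (hx : x ∈ frontier K) :
    ∃ y ∈ K, r ≤ dist y x := by
  obtain ⟨y, hy, hmax⟩ := hK.exists_isMaxOn ⟨x, hKc.frontier_subset hx⟩
    (f := fun y => dist y x) (by fun_prop)
  refine ⟨y, hy, ?_⟩
  by_contra! hlt
  refine hx.2 (mem_interior_iff_mem_nhds.2 (Filter.mem_of_superset
    (ball_mem_nhds x (sub_pos.2 hlt)) fun z hz => hsub fun w hw => ?_))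
  have h₁ : dist w x ≤ dist y x := hmax hw
  have h₂ := dist_triangle w x z
  rw [mem_ball, dist_comm] at hz
  rw [mem_closedBall]
  linarith

/-- A point of `K` realizing the radius of a closed ball which contains `K` is a frontier point. -/
lemma mem_frontier_of_subset_closedBall {E : Type*} [NormedAddCommGroup E] [NormedSpace ℝ E]
    {K : Set E} {x y : E} {r : ℝ} (hr : 0 < r) (hK : K ⊆ closedBall y r) (hx : x ∈ K)
    (hxy : dist x y = r) : x ∈ frontier K := by
  refine ⟨subset_closure hx, fun hint => ?_⟩
  have h := interior_mono hK hint
  rw [interior_closedBall y hr.ne', mem_ball, hxy] at h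
  exact lt_irrefl _ h

end BallHull

/-- The second-order necessary condition for a local maximum. -/
lemma IsLocalMax.deriv_deriv_nonpos {f : ℝ → ℝ} {a : ℝ} (h : IsLocalMax f a)
    (hc : ContinuousAt f a) : deriv (deriv f) a ≤ 0 := by
  by_contra! hpos
  have hmin := isLocalMin_of_deriv_deriv_pos hpos h.deriv_eq_zero hc
  have hconst : f =ᶠ[nhds a] fun _ => f a := by
    filter_upwards [h, hmin] with x h₁ h₂ using le_antisymm h₁ h₂
  have := hconst.deriv.deriv_eq
  simp at this
  linarith

section Plane

/-- The rotation of a plane vector by a quarter turn counterclockwise. -/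
def leftNormal (v : EuclideanSpace ℝ (Fin 2)) : EuclideanSpace ℝ (Fin 2) := !₂[-v 1, v 0]

@[simp] lemma leftNormal_apply_zero (v : EuclideanSpace ℝ (Fin 2)) : leftNormal v 0 = -v 1 := rfl

@[simp] lemma leftNormal_apply_one (v : EuclideanSpace ℝ (Fin 2)) : leftNormal v 1 = v 0 := rfl

lemma leftNormal_neg (v : EuclideanSpace ℝ (Fin 2)) : leftNormal (-v) = -leftNormal v := by
  ext i; fin_cases i <;> simp

lemma norm_leftNormal (v : EuclideanSpace ℝ (Fin 2)) : ‖leftNormal v‖ = ‖v‖ := by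
  simp [EuclideanSpace.norm_eq, Fin.sum_univ_two, add_comm]

lemma leftNormal_injective : Function.Injective leftNormal := by
  intro v w h
  have h₀ : -v 1 = -w 1 := congrArg (fun u => u 0) h
  have h₁ : v 0 = w 0 := congrArg (fun u => u 1) h
  ext i
  fin_cases i
  · exact h₁
  · exact neg_injective h₀

lemma dist_sq_eq_fin_two (x y : EuclideanSpace ℝ (Fin 2)) :
    dist x y ^ 2 = (x 0 - y 0) ^ 2 + (x 1 - y 1) ^ 2 := by
  rw [dist_eq_norm, EuclideanSpace.real_norm_sq_eq]
  simp [Fin.sum_univ_two]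

lemma HasDerivAt.euclidean_apply {f : ℝ → EuclideanSpace ℝ (Fin 2)}
    {f' : EuclideanSpace ℝ (Fin 2)} {s : ℝ} (h : HasDerivAt f f' s) (i : Fin 2) :
    HasDerivAt (fun t => f t i) (f' i) s :=
  (EuclideanSpace.proj (𝕜 := ℝ) i).hasFDerivAt.comp_hasDerivAt s h

end Plane

section UnitSpeed

variable {γ : ℝ → EuclideanSpace ℝ (Fin 2)}

lemma ContDiff.hasDerivAt_deriv_of_two (hγ : ContDiff ℝ 2 γ) (s : ℝ) :
    HasDerivAt γ (deriv γ s) s :=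
  (hγ.differentiable (by norm_num) s).hasDerivAt

lemma ContDiff.hasDerivAt_deriv_deriv_of_two (hγ : ContDiff ℝ 2 γ) (s : ℝ) :
    HasDerivAt (deriv γ) (deriv (deriv γ) s) s :=
  ((hγ.deriv' (n := 1)).differentiable (by norm_num) s).hasDerivAt

lemma deriv_sq_add_deriv_sq (hspeed : ∀ s, ‖deriv γ s‖ = 1) (s : ℝ) :
    deriv γ s 0 ^ 2 + deriv γ s 1 ^ 2 = 1 := by
  have h := EuclideanSpace.real_norm_sq_eq (deriv γ s)
  rw [hspeed, Fin.sum_univ_two] at h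
  linarith

/-- The signed curvature of a unit-speed plane curve. -/
noncomputable def signedCurvature (γ : ℝ → EuclideanSpace ℝ (Fin 2)) (s : ℝ) : ℝ :=
  deriv γ s 0 * deriv (deriv γ) s 1 - deriv γ s 1 * deriv (deriv γ) s 0

/-- The Frenet equation of a unit-speed plane curve. -/
lemma deriv_deriv_eq_signedCurvature_smul (hγ : ContDiff ℝ 2 γ) (hspeed : ∀ s, ‖deriv γ s‖ = 1)
    (s : ℝ) : deriv (deriv γ) s = signedCurvature γ s • leftNormal (deriv γ s) := by
  have h₀ := (hγ.hasDerivAt_deriv_deriv_of_two s).euclidean_apply 0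
  have h₁ := (hγ.hasDerivAt_deriv_deriv_of_two s).euclidean_apply 1
  have hsum := (h₀.pow 2).add (h₁.pow 2)
  have hconst : (fun t => deriv γ t 0) ^ 2 + (fun t => deriv γ t 1) ^ 2 = fun _ => (1 : ℝ) :=
    funext fun t => deriv_sq_add_deriv_sq hspeed t
  rw [hconst] at hsum
  have horth := hsum.unique (hasDerivAt_const s 1)
  have hunit := deriv_sq_add_deriv_sq hspeed s
  ext i
  fin_cases i
  · simp [signedCurvature] at horth ⊢
    linear_combination (-deriv (deriv γ) s 0) * hunit + (deriv γ s 0 / 2) * horth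
  · simp [signedCurvature] at horth ⊢
    linear_combination (-deriv (deriv γ) s 1) * hunit + (deriv γ s 1 / 2) * horth

lemma hasDerivAt_deriv_apply_zero (hγ : ContDiff ℝ 2 γ) (hspeed : ∀ s, ‖deriv γ s‖ = 1) (s : ℝ) :
    HasDerivAt (fun t => deriv γ t 0) (-(signedCurvature γ s * deriv γ s 1)) s := by
  convert (hγ.hasDerivAt_deriv_deriv_of_two s).euclidean_apply 0 using 1
  rw [deriv_deriv_eq_signedCurvature_smul hγ hspeed]
  simp

lemma hasDerivAt_deriv_apply_one (hγ : ContDiff ℝ 2 γ) (hspeed : ∀ s, ‖deriv γ s‖ = 1) (s : ℝ) :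
    HasDerivAt (fun t => deriv γ t 1) (signedCurvature γ s * deriv γ s 0) s := by
  convert (hγ.hasDerivAt_deriv_deriv_of_two s).euclidean_apply 1 using 1
  rw [deriv_deriv_eq_signedCurvature_smul hγ hspeed]
  simp

lemma continuous_signedCurvature (hγ : ContDiff ℝ 2 γ) : Continuous (signedCurvature γ) := by
  have h₁ : Continuous (deriv γ) := hγ.continuous_deriv (by norm_num)
  have h₂ : Continuous (deriv (deriv γ)) := (hγ.deriv' (n := 1)).continuous_deriv (by norm_num)
  unfold signedCurvature
  fun_prop

/-- The tangent of a unit-speed plane curve turns by the angle whose derivative is the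
curvature. -/
lemma deriv_eq_cos_smul_add_sin_smul (hγ : ContDiff ℝ 2 γ) (hspeed : ∀ s, ‖deriv γ s‖ = 1)
    {θ : ℝ → ℝ} (hθ : ∀ s, HasDerivAt θ (signedCurvature γ s) s) (s t : ℝ) :
    deriv γ t = Real.cos (θ t - θ s) • deriv γ s +
      Real.sin (θ t - θ s) • leftNormal (deriv γ s) := by
  have h₀ := hasDerivAt_deriv_apply_zero hγ hspeed
  have h₁ := hasDerivAt_deriv_apply_one hγ hspeed
  have hθs (u : ℝ) := (hθ u).sub_const (θ s)
  have hA (u : ℝ) := ((h₀ u).mul (hθs u).cos).add ((h₁ u).mul (hθs u).sin)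
  have hB (u : ℝ) := ((h₁ u).mul (hθs u).cos).sub ((h₀ u).mul (hθs u).sin)
  have eA := is_const_of_deriv_eq_zero (fun u => (hA u).differentiableAt)
    (fun u => (hA u).deriv.trans (by ring)) t s
  have eB := is_const_of_deriv_eq_zero (fun u => (hB u).differentiableAt)
    (fun u => (hB u).deriv.trans (by ring)) t s
  simp at eA eB
  have hcs := Real.sin_sq_add_cos_sq (θ t - θ s)
  ext i
  fin_cases i
  · simp
    linear_combination Real.cos (θ t - θ s) * eA - Real.sin (θ t - θ s) * eB -
      deriv γ t 0 * hcs
  · simp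
    linear_combination Real.sin (θ t - θ s) * eA + Real.cos (θ t - θ s) * eB -
      deriv γ t 1 * hcs

/-- A point from which a positively curved unit-speed curve is farthest at parameter `s` lies on
the left normal at `s`. -/
lemma eq_add_smul_leftNormal_of_forall_dist_le (hγ : ContDiff ℝ 2 γ)
    (hspeed : ∀ s, ‖deriv γ s‖ = 1) {s : ℝ} (hκ : 0 < signedCurvature γ s)
    {x : EuclideanSpace ℝ (Fin 2)} (hmax : ∀ t, dist (γ t) x ≤ dist (γ s) x) :
    x = γ s + dist (γ s) x • leftNormal (deriv γ s) := by
  set f : ℝ → ℝ := fun t => (γ t 0 - x 0) ^ 2 + (γ t 1 - x 1) ^ 2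
  have hf (t : ℝ) : HasDerivAt f
      (2 * ((γ t 0 - x 0) * deriv γ t 0 + (γ t 1 - x 1) * deriv γ t 1)) t := by
    have h := ((((hγ.hasDerivAt_deriv_of_two t).euclidean_apply 0).sub_const (x 0)).pow 2).add
      ((((hγ.hasDerivAt_deriv_of_two t).euclidean_apply 1).sub_const (x 1)).pow 2)
    refine h.congr_deriv ?_
    simp
    ring
  have hfmax : IsLocalMax f s := Filter.Eventually.of_forall fun t => by
    simp only [f, ← dist_sq_eq_fin_two]
    gcongr
    exact hmax t
  have hderiv : deriv f =
      fun t => 2 * ((γ t 0 - x 0) * deriv γ t 0 + (γ t 1 - x 1) * deriv γ t 1) :=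
    funext fun t => (hf t).deriv
  have h₁ := hfmax.deriv_eq_zero
  have h₂ := hfmax.deriv_deriv_nonpos (hf s).continuousAt
  have h₃ := (((((hγ.hasDerivAt_deriv_of_two s).euclidean_apply 0).sub_const (x 0)).mul
    (hasDerivAt_deriv_apply_zero hγ hspeed s)).add
    ((((hγ.hasDerivAt_deriv_of_two s).euclidean_apply 1).sub_const (x 1)).mul
    (hasDerivAt_deriv_apply_one hγ hspeed s))).const_mul 2
  rw [hderiv] at h₁ h₂
  have h₄ := h₃.deriv.ge.trans h₂
  have hunit := deriv_sq_add_deriv_sq hspeed s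
  have hd := dist_sq_eq_fin_two (γ s) x
  set w := deriv γ s 0 * (γ s 1 - x 1) - deriv γ s 1 * (γ s 0 - x 0) with hw_def
  have hw : w < 0 := by
    have : 1 + signedCurvature γ s * w ≤ 0 := by
      linear_combination (1 / 2) * h₄ - hunit
    by_contra! hw
    linarith [mul_nonneg hκ.le hw]
  have hwd : w = -dist (γ s) x := by
    have hsq : w ^ 2 = dist (γ s) x ^ 2 := by
      linear_combination (-(1 / 2) * ((γ s 0 - x 0) * deriv γ s 0 +
        (γ s 1 - x 1) * deriv γ s 1)) * h₁ - hd +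
        ((γ s 0 - x 0) ^ 2 + (γ s 1 - x 1) ^ 2) * hunit
    rcases sq_eq_sq_iff_eq_or_eq_neg.1 hsq with h | h
    · linarith [dist_nonneg (x := γ s) (y := x)]
    · exact h
  ext i
  fin_cases i
  · simp
    linear_combination (-deriv γ s 0 / 2) * h₁ + deriv γ s 1 * hwd + (γ s 0 - x 0) * hunit
  · simp
    linear_combination (-deriv γ s 1 / 2) * h₁ - deriv γ s 0 * hwd + (γ s 1 - x 1) * hunit

end UnitSpeed

section TurningAngle

variable {γ : ℝ → EuclideanSpace ℝ (Fin 2)} {θ : ℝ → ℝ}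

lemma deriv_add_period {L : ℝ} (hper : Function.Periodic γ L) (s : ℝ) :
    deriv γ (s + L) = deriv γ s := by
  rw [← deriv_comp_add_const, show (fun t => γ (t + L)) = γ from funext hper]

lemma signedCurvature_periodic {L : ℝ} (hper : Function.Periodic γ L) :
    Function.Periodic (signedCurvature γ) L := fun s => by
  simp only [signedCurvature, deriv_add_period hper, deriv_add_period (deriv_add_period hper)]

lemma deriv_eq_of_angle_eq_add_two_pi (hγ : ContDiff ℝ 2 γ) (hspeed : ∀ s, ‖deriv γ s‖ = 1)
    (hθ : ∀ s, HasDerivAt θ (signedCurvature γ s) s) {s t : ℝ}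
    (h : θ t = θ s + 2 * Real.pi) : deriv γ t = deriv γ s := by
  simp [deriv_eq_cos_smul_add_sin_smul hγ hspeed hθ s t, h]

lemma deriv_eq_neg_of_angle_eq_add_pi (hγ : ContDiff ℝ 2 γ) (hspeed : ∀ s, ‖deriv γ s‖ = 1)
    (hθ : ∀ s, HasDerivAt θ (signedCurvature γ s) s) {s t : ℝ}
    (h : θ t = θ s + Real.pi) : deriv γ t = -deriv γ s := by
  simp [deriv_eq_cos_smul_add_sin_smul hγ hspeed hθ s t, h]

lemma angle_add_two_pi_le (hγ : ContDiff ℝ 2 γ) (hspeed : ∀ s, ‖deriv γ s‖ = 1)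
    (hθ : ∀ s, HasDerivAt θ (signedCurvature γ s) s) {s t : ℝ} (hlt : θ s < θ t)
    (h : deriv γ t = deriv γ s) : θ s + 2 * Real.pi ≤ θ t := by
  have hrot := deriv_eq_cos_smul_add_sin_smul hγ hspeed hθ s t
  rw [h] at hrot
  have h₀ := congrArg (fun v => v 0) hrot
  have h₁ := congrArg (fun v => v 1) hrot
  have hunit := deriv_sq_add_deriv_sq hspeed s
  simp at h₀ h₁
  have hcos : Real.cos (θ t - θ s) = 1 := by
    linear_combination (-deriv γ s 0) * h₀ - deriv γ s 1 * h₁ +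
      (1 - Real.cos (θ t - θ s)) * hunit
  by_contra! hlt'
  have := (Real.cos_eq_one_iff_of_lt_of_lt (by linarith [Real.pi_pos]) (by linarith)).1 hcos
  linarith

end TurningAngle

section ConstantWidth

variable {K : Set (EuclideanSpace ℝ (Fin 2))} {γ : ℝ → EuclideanSpace ℝ (Fin 2)} {r : ℝ}

lemma eq_antipode_of_dist_eq (hγ : ContDiff ℝ 2 γ) (hspeed : ∀ s, ‖deriv γ s‖ = 1)
    (hκ : ∀ s, 0 < signedCurvature γ s) (hK : IsClosed K) (hrange : frontier K = Set.range γ)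
    (hwidth : {x | K ⊆ closedBall x r} = K) {s : ℝ} {x : EuclideanSpace ℝ (Fin 2)} (hx : x ∈ K)
    (hdist : dist (γ s) x = r) : x = γ s + r • leftNormal (deriv γ s) := by
  have hsub : K ⊆ closedBall x r := by
    rw [← hwidth] at hx
    exact hx
  have h := eq_add_smul_leftNormal_of_forall_dist_le hγ hspeed (hκ s) (x := x) fun t =>
    hdist ▸ hsub (hK.frontier_subset (hrange ▸ Set.mem_range_self t))
  rwa [hdist] at h

lemma antipode_mem (hγ : ContDiff ℝ 2 γ) (hspeed : ∀ s, ‖deriv γ s‖ = 1)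
    (hκ : ∀ s, 0 < signedCurvature γ s) (hK : IsCompact K) (hrange : frontier K = Set.range γ)
    (hwidth : {x | K ⊆ closedBall x r} = K) (s : ℝ) :
    γ s + r • leftNormal (deriv γ s) ∈ K := by
  have hs : γ s ∈ frontier K := hrange ▸ Set.mem_range_self s
  obtain ⟨y, hy, hry⟩ := exists_mem_le_dist_of_mem_frontier hK hK.isClosed hwidth.subset hs
  have hsub : K ⊆ closedBall y r := by
    rw [← hwidth] at hy
    exact hy
  have hdist : dist (γ s) y = r :=
    le_antisymm (hsub (hK.isClosed.frontier_subset hs)) (dist_comm y (γ s) ▸ hry)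
  rwa [← eq_antipode_of_dist_eq hγ hspeed hκ hK.isClosed hrange hwidth hy hdist]

lemma dist_antipode (hspeed : ∀ s, ‖deriv γ s‖ = 1) (hr : 0 < r) (s : ℝ) :
    dist (γ s + r • leftNormal (deriv γ s)) (γ s) = r := by
  rw [dist_eq_norm, add_sub_cancel_left, norm_smul, norm_leftNormal, hspeed, mul_one,
    Real.norm_of_nonneg hr.le]

/-- The antipode of a boundary point is a boundary point with the opposite tangent. -/
lemma exists_eq_antipode (hγ : ContDiff ℝ 2 γ) (hspeed : ∀ s, ‖deriv γ s‖ = 1)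
    (hκ : ∀ s, 0 < signedCurvature γ s) (hK : IsCompact K) (hrange : frontier K = Set.range γ)
    (hr : 0 < r) (hwidth : {x | K ⊆ closedBall x r} = K) (s : ℝ) :
    ∃ t, γ t = γ s + r • leftNormal (deriv γ s) ∧ deriv γ t = -deriv γ s := by
  have hsK : γ s ∈ K := hK.isClosed.frontier_subset (hrange ▸ Set.mem_range_self s)
  have hsub : K ⊆ closedBall (γ s) r := by
    rw [← hwidth] at hsK
    exact hsK
  have hfr := mem_frontier_of_subset_closedBall hr hsub
    (antipode_mem hγ hspeed hκ hK hrange hwidth s) (dist_antipode hspeed hr s)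
  rw [hrange] at hfr
  obtain ⟨t, ht⟩ := hfr
  refine ⟨t, ht, leftNormal_injective ?_⟩
  have h := eq_antipode_of_dist_eq hγ hspeed hκ hK.isClosed hrange hwidth hsK
    (ht ▸ dist_antipode hspeed hr s)
  rw [ht, add_assoc, left_eq_add, ← smul_add, smul_eq_zero_iff_right hr.ne'] at h
  rw [leftNormal_neg]
  exact eq_neg_of_add_eq_zero_right h

/-- The tangent determines the boundary point of a body of constant width. -/
lemma eq_of_deriv_eq (hγ : ContDiff ℝ 2 γ) (hspeed : ∀ s, ‖deriv γ s‖ = 1)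
    (hκ : ∀ s, 0 < signedCurvature γ s) (hK : IsCompact K) (hrange : frontier K = Set.range γ)
    (hr : 0 < r) (hwidth : {x | K ⊆ closedBall x r} = K) {s t : ℝ}
    (hst : deriv γ s = deriv γ t) : γ s = γ t := by
  have hdist (s t : ℝ) : dist (γ s + r • leftNormal (deriv γ s)) (γ t) ≤ r := by
    have ht : γ t ∈ K := hK.isClosed.frontier_subset (hrange ▸ Set.mem_range_self t)
    rw [← hwidth] at ht
    exact ht (antipode_mem hγ hspeed hκ hK hrange hwidth s)
  have h₁ := hdist s t
  have h₂ := hdist t s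
  have h₀ := dist_antipode hspeed hr s
  rw [← hst] at h₂
  rw [dist_eq_norm] at h₀ h₁ h₂
  have hpar := parallelogram_law_with_norm ℝ (r • leftNormal (deriv γ s)) (γ s - γ t)
  rw [show r • leftNormal (deriv γ s) + (γ s - γ t) =
      γ s + r • leftNormal (deriv γ s) - γ t by abel,
    show r • leftNormal (deriv γ s) - (γ s - γ t) =
      γ t + r • leftNormal (deriv γ s) - γ s by abel] at hpar
  rw [add_sub_cancel_left] at h₀
  rw [h₀] at hpar
  rw [← sub_eq_zero, ← norm_eq_zero]
  have h₃ := mul_self_le_mul_self (norm_nonneg _) h₁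
  have h₄ := mul_self_le_mul_self (norm_nonneg _) h₂
  nlinarith [norm_nonneg (γ s - γ t)]

end ConstantWidth

section AngleFunction

/-- A continuous function bounded below by a positive constant has an increasing bijective
antiderivative. -/
lemma exists_orderIso_hasDerivAt {κ : ℝ → ℝ} (hκ : Continuous κ) {c : ℝ} (hc : 0 < c)
    (hcκ : ∀ s, c ≤ κ s) : ∃ θ : ℝ ≃o ℝ, ∀ s, HasDerivAt θ (κ s) s := by
  set f : ℝ → ℝ := fun s => ∫ u in (0 : ℝ)..s, κ u
  have hf (s : ℝ) : HasDerivAt f (κ s) s := (hκ.integral_hasStrictDerivAt 0 s).hasDerivAt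
  have hdiff : Differentiable ℝ f := fun s => (hf s).differentiableAt
  have hlow := mul_sub_le_image_sub_of_le_deriv hdiff (C := c) fun s => (hf s).deriv ▸ hcκ s
  have hmono : StrictMono f := fun x y hxy => by
    nlinarith [hlow hxy.le, mul_pos hc (sub_pos.2 hxy)]
  have hsurj : Function.Surjective f := hdiff.continuous.surjective
    (Filter.tendsto_atTop_mono' _ (by
      filter_upwards [Filter.eventually_ge_atTop 0] with s hs
      have := hlow hs
      rw [id_eq]
      linarith) (Filter.tendsto_atTop_add_const_right _ (f 0 - c * 0)
        (Filter.tendsto_id.const_mul_atTop hc)))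
    (Filter.tendsto_atBot_mono' _ (by
      filter_upwards [Filter.eventually_le_atBot 0] with s hs
      have := hlow hs
      rw [id_eq]
      linarith) (Filter.tendsto_atBot_add_const_right _ (f 0 - c * 0)
        (Filter.tendsto_id.const_mul_atBot hc)))
  exact ⟨hmono.orderIsoOfSurjective f hsurj, hf⟩

/-- Two parameters with the same image under a curve which is injective on a period differ by an
integer multiple of the period. -/
lemma Function.Periodic.exists_sub_eq_zsmul_of_injOn {α : Type*} {f : ℝ → α} {L : ℝ}
    (hf : Function.Periodic f L) (hL : 0 < L) (hinj : Set.InjOn f (Set.Ico 0 L)) {s t : ℝ}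
    (hst : f s = f t) : ∃ n : ℤ, t - s = n • L := by
  rw [← toIcoMod_eq_toIcoMod hL (a := 0)]
  have hmem (u : ℝ) : toIcoMod hL 0 u ∈ Set.Ico 0 L := by
    simpa using toIcoMod_mem_Ico hL 0 u
  refine hinj (hmem s) (hmem t) ?_
  have hval (u : ℝ) : f (toIcoMod hL 0 u) = f u := hf.sub_zsmul_eq _
  rw [hval, hval, hst]

end AngleFunction

section Antipode

variable {K : Set (EuclideanSpace ℝ (Fin 2))} {γ : ℝ → EuclideanSpace ℝ (Fin 2)} {r L : ℝ}

/-- On the boundary of a body of constant width `r`, passing to the antipode corresponds to a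
change of the arc-length parameter with derivative `r * κ - 1`. -/
lemma exists_antipodal_reparametrization (hγ : ContDiff ℝ 2 γ) (hspeed : ∀ s, ‖deriv γ s‖ = 1)
    (hκ : ∀ s, 1 / r < signedCurvature γ s) (hK : IsCompact K)
    (hrange : frontier K = Set.range γ) (hr : 0 < r) (hwidth : {x | K ⊆ closedBall x r} = K)
    (hL : 0 < L) (hper : Function.Periodic γ L) (hinj : Set.InjOn γ (Set.Ico 0 L)) :
    ∃ φ : ℝ → ℝ, (∀ s, HasDerivAt φ (r * signedCurvature γ s - 1) s) ∧
      (∀ s, φ (s + L) = φ s + L) ∧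
      ∀ s, signedCurvature γ (φ s) * (r * signedCurvature γ s - 1) = signedCurvature γ s := by
  have hr' : 0 < 1 / r := one_div_pos.2 hr
  have hκ0 (s : ℝ) : 0 < signedCurvature γ s := hr'.trans (hκ s)
  obtain ⟨θ, hθ⟩ := exists_orderIso_hasDerivAt (continuous_signedCurvature hγ) hr'
    fun s => (hκ s).le
  set φ : ℝ → ℝ := fun s => θ.symm (θ s + Real.pi)
  have hθφ (s : ℝ) : θ (φ s) = θ s + Real.pi := θ.apply_symm_apply _
  have hφT (s : ℝ) : deriv γ (φ s) = -deriv γ s :=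
    deriv_eq_neg_of_angle_eq_add_pi hγ hspeed hθ (hθφ s)
  have hφγ (s : ℝ) : γ (φ s) = γ s + r • leftNormal (deriv γ s) := by
    obtain ⟨t, ht, hTt⟩ := exists_eq_antipode hγ hspeed hκ0 hK hrange hr hwidth s
    rw [← ht]
    exact eq_of_deriv_eq hγ hspeed hκ0 hK hrange hr hwidth ((hφT s).trans hTt.symm)
  have hφd (s : ℝ) : HasDerivAt φ ((signedCurvature γ (φ s))⁻¹ * signedCurvature γ s) s := by
    have hsymm : HasDerivAt θ.symm (signedCurvature γ (φ s))⁻¹ (θ s + Real.pi) :=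
      HasDerivAt.of_local_left_inverse θ.symm.continuous.continuousAt (hθ _) (hκ0 _).ne'
        (Filter.Eventually.of_forall θ.apply_symm_apply)
    exact hsymm.comp s ((hθ s).add_const Real.pi)
  have hφ' (s : ℝ) : (signedCurvature γ (φ s))⁻¹ * signedCurvature γ s =
      r * signedCurvature γ s - 1 := by
    have hl := (hγ.hasDerivAt_deriv_of_two (φ s)).scomp s (hφd s)
    have hl₀ := hl.euclidean_apply 0
    have hl₁ := hl.euclidean_apply 1
    have hr₀ := ((hγ.hasDerivAt_deriv_of_two s).euclidean_apply 0).add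
      ((hasDerivAt_deriv_apply_one hγ hspeed s).neg.const_mul r)
    have hr₁ := ((hγ.hasDerivAt_deriv_of_two s).euclidean_apply 1).add
      ((hasDerivAt_deriv_apply_zero hγ hspeed s).const_mul r)
    have e₀ := hl₀.unique (hr₀.congr_of_eventuallyEq (Filter.Eventually.of_forall fun t => by
      simp [hφγ]))
    have e₁ := hl₁.unique (hr₁.congr_of_eventuallyEq (Filter.Eventually.of_forall fun t => by
      simp [hφγ]))
    have hunit := deriv_sq_add_deriv_sq hspeed s
    simp only [hφT, PiLp.smul_apply, PiLp.neg_apply, smul_eq_mul] at e₀ e₁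
    linear_combination (-deriv γ s 0) * e₀ - deriv γ s 1 * e₁ + (r * signedCurvature γ s - 1 -
      (signedCurvature γ (φ s))⁻¹ * signedCurvature γ s) * hunit
  have hφφ (s : ℝ) : φ (φ s) = s + L := by
    have hθ2 : θ (φ (φ s)) = θ s + 2 * Real.pi := by rw [hθφ, hθφ]; ring
    have hle : φ (φ s) ≤ s + L := by
      rw [← θ.le_iff_le, hθ2]
      exact angle_add_two_pi_le hγ hspeed hθ (θ.strictMono (by linarith))
        (deriv_add_period hper s)
    obtain ⟨n, hn⟩ := hper.exists_sub_eq_zsmul_of_injOn hL hinj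
      (eq_of_deriv_eq hγ hspeed hκ0 hK hrange hr hwidth
        (deriv_eq_of_angle_eq_add_two_pi hγ hspeed hθ hθ2).symm)
    have hlt : s < φ (φ s) := by
      rw [← θ.lt_iff_lt, hθ2]
      linarith [Real.pi_pos]
    rw [zsmul_eq_mul] at hn
    have hn0 : (0 : ℝ) < n := pos_of_mul_pos_left (by linarith) hL.le
    have hn1 : (1 : ℝ) ≤ n := by exact_mod_cast hn0
    nlinarith
  refine ⟨φ, fun s => hφ' s ▸ hφd s, fun s => ?_, fun s => ?_⟩
  · rw [← hφφ s, hφφ]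
  · rw [← hφ', mul_inv_cancel_left₀ (hκ0 _).ne']

end Antipode

/-- Let `K` be a planar convex body of constant width `r` (i.e. `K^{*,r} = K`) whose
boundary has a periodic `C²` unit-speed parametrization `γ` (period `L` = the perimeter)
with curvature `κ > 1/r` everywhere. Then for every real `p`,
`∫_{∂K} (κ(x) - 1/r)^p dx = r^{1-2p} · ∫_{∂K} (κ(x) - 1/r)^{1-p} dx`,
the integrals being taken with respect to arc length (i.e. over one period of `γ`). -/
theorem constant_width_curvature_integral_identity
    (K : Set (EuclideanSpace ℝ (Fin 2)))
    (hKcomp : IsCompact K) (hKconv : Convex ℝ K) (hKint : (interior K).Nonempty)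
    (r : ℝ) (hr : 0 < r)
    (γ : ℝ → EuclideanSpace ℝ (Fin 2)) (hγ : ContDiff ℝ 2 γ)
    (hγspeed : ∀ s, ‖deriv γ s‖ = 1)
    (L : ℝ) (hL : 0 < L) (hper : ∀ s, γ (s + L) = γ s)
    (hinj : Set.InjOn γ (Set.Ico 0 L))
    (hγrange : frontier K = Set.range γ)
    (κ : ℝ → ℝ)
    (hκdef : ∀ s, κ s =
      deriv γ s 0 * deriv (deriv γ) s 1 - deriv γ s 1 * deriv (deriv γ) s 0)
    (hκ : ∀ s, 1 / r < κ s)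
    (hwidth : {x | K ⊆ closedBall x r} = K) :
    ∀ p : ℝ,
      (∫ s in Set.Ico (0:ℝ) L, (κ s - 1 / r) ^ p) =
        r ^ (1 - 2 * p) * ∫ s in Set.Ico (0:ℝ) L, (κ s - 1 / r) ^ (1 - p) := by
  intro p
  obtain rfl : κ = signedCurvature γ := funext hκdef
  have hcont := continuous_signedCurvature hγ
  have hpos (s : ℝ) : 0 < signedCurvature γ s - 1 / r := sub_pos.2 (hκ s)
  obtain ⟨φ, hφ, hφL, hκφ⟩ := exists_antipodal_reparametrization hγ hγspeed hκ hKcomp hγrange hr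
    hwidth hL hper hinj
  have hF : Continuous fun s => (signedCurvature γ s - 1 / r) ^ p :=
    (hcont.sub continuous_const).rpow_const fun s => Or.inl (hpos s).ne'
  have hFper : Function.Periodic (fun s => (signedCurvature γ s - 1 / r) ^ p) L := fun s => by
    simp only [signedCurvature_periodic hper s]
  have hsubst := intervalIntegral.integral_comp_mul_deriv (a := 0) (b := L) (fun s _ => hφ s)
    (by fun_prop) hF
  have hφ0L : φ L = φ 0 + L := by simpa using hφL 0
  rw [hφ0L, hFper.intervalIntegral_add_eq (φ 0) 0, zero_add] at hsubst
  simp only [MeasureTheory.integral_Ico_eq_integral_Ioc, ← intervalIntegral.integral_of_le hL.le]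
  rw [← hsubst, ← intervalIntegral.integral_const_mul]
  refine intervalIntegral.integral_congr fun s _ => ?_
  have hfac : r * signedCurvature γ s - 1 = r * (signedCurvature γ s - 1 / r) := by
    field_simp
  have hinv : signedCurvature γ (φ s) - 1 / r =
      (r ^ 2 * (signedCurvature γ s - 1 / r))⁻¹ := by
    have hne := (mul_pos hr (hpos s)).ne'
    refine eq_inv_of_mul_eq_one_left ?_
    have h := hκφ s
    rw [hfac] at h
    have hrr : r * (1 / r) = 1 := mul_one_div_cancel hr.ne'
    linear_combination r * h + (1 - r * (signedCurvature γ s - 1 / r)) * hrr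
  simp only [Function.comp_apply]
  rw [hinv, hfac, Real.inv_rpow (by have := hpos s; positivity),
    Real.mul_rpow (by positivity) (hpos s).le, ← Real.rpow_natCast r 2, ← Real.rpow_mul hr.le,
    Real.rpow_sub hr, Real.rpow_sub (hpos s), Real.rpow_one, Real.rpow_one]
  push_cast
  have h₁ := Real.rpow_pos_of_pos hr (2 * p)
  have h₂ := Real.rpow_pos_of_pos (hpos s) p
  field_simp
end

section
/- Let K be a planar convex body with C² boundary and minimal curvature κ_m > 1. Then there exists δ > 0 depending only on K such that for any two points x, y in the interior of K, the larger of the two disc-caps of K cut off by the two unit circles through x and y has area greater than δ. -/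
open Metric MeasureTheory
open scoped RealInnerProductSpace

/-- A plane unit-speed curve of curvature `> 1` turns around (reaches the opposite tangent
direction) after rising by less than `2` above the tangent line at its starting point. -/
lemma exists_opposite_tangent {f g u v κ : ℝ → ℝ} (hf : ∀ s, HasDerivAt f (u s) s)
    (hg : ∀ s, HasDerivAt g (v s) s) (hu : ∀ s, HasDerivAt u (-(κ s * v s)) s)
    (hv : ∀ s, HasDerivAt v (κ s * u s) s) (huv : ∀ s, u s ^ 2 + v s ^ 2 = 1)
    (hκc : Continuous κ) (hκ : ∀ s, 1 < κ s) (a : ℝ) :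
    ∃ b, u b = -u a ∧ v b = -v a ∧
      0 < (g b - g a) * u a - (f b - f a) * v a ∧
      (g b - g a) * u a - (f b - f a) * v a < 2 := by
  set θ : ℝ → ℝ := fun s => ∫ t in a..s, κ t with hθ
  have hθd : ∀ s, HasDerivAt θ (κ s) s := fun s => hκc.integral_hasStrictDerivAt a s |>.hasDerivAt
  have hθa : θ a = 0 := by simp [hθ]
  have hθc : Continuous θ := continuous_iff_continuousAt.2 fun s => (hθd s).continuousAt
  have hθm : StrictMono θ := strictMono_of_deriv_pos fun s => by
    rw [(hθd s).deriv]; linarith [hκ s]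
  have hF : ∀ s, u s * Real.cos (θ s) + v s * Real.sin (θ s) = u a := by
    intro s
    have hd : ∀ s, HasDerivAt (fun s => u s * Real.cos (θ s) + v s * Real.sin (θ s)) 0 s := by
      intro s
      exact (((hu s).mul (hθd s).cos).add ((hv s).mul (hθd s).sin)).congr_deriv (by ring)
    have := is_const_of_deriv_eq_zero (fun s => (hd s).differentiableAt) (fun s => (hd s).deriv) s a
    simpa [hθa] using this
  have hG : ∀ s, v s * Real.cos (θ s) - u s * Real.sin (θ s) = v a := by
    intro s
    have hd : ∀ s, HasDerivAt (fun s => v s * Real.cos (θ s) - u s * Real.sin (θ s)) 0 s := by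
      intro s
      exact (((hv s).mul (hθd s).cos).sub ((hu s).mul (hθd s).sin)).congr_deriv (by ring)
    have := is_const_of_deriv_eq_zero (fun s => (hd s).differentiableAt) (fun s => (hd s).deriv) s a
    simpa [hθa] using this
  have hsin : ∀ s, v s * u a - u s * v a = Real.sin (θ s) := by
    intro s
    rw [← hF s, ← hG s]
    linear_combination Real.sin (θ s) * huv s
  have hπ : Real.pi ≤ θ (a + Real.pi) := by
    have hd : ∀ s, HasDerivAt (fun s => θ s - s) (κ s - 1) s := fun s => (hθd s).sub (hasDerivAt_id s)
    have hm : Monotone fun s => θ s - s := monotone_of_deriv_nonneg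
      (fun s => (hd s).differentiableAt) fun s => by rw [(hd s).deriv]; linarith [hκ s]
    have := hm (show a ≤ a + Real.pi by linarith [Real.pi_pos])
    simp only [hθa] at this
    linarith
  obtain ⟨b, -, hb⟩ : Real.pi ∈ θ '' Set.Icc a (a + Real.pi) :=
    intermediate_value_Icc (by linarith [Real.pi_pos]) hθc.continuousOn
      ⟨by rw [hθa]; exact Real.pi_pos.le, hπ⟩
  have hab : a < b := hθm.lt_iff_lt.1 (by rw [hθa, hb]; exact Real.pi_pos)
  have hpos : ∀ s ∈ Set.Ioo a b, 0 < Real.sin (θ s) := fun s hs =>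
    Real.sin_pos_of_pos_of_lt_pi (hθa ▸ hθm hs.1) (hb ▸ hθm hs.2)
  set H : ℝ → ℝ := fun s => (g s - g a) * u a - (f s - f a) * v a with hH
  have hHd : ∀ s, HasDerivAt H (Real.sin (θ s)) s := by
    intro s
    rw [← hsin s]
    exact (((hg s).sub_const _).mul_const _).sub (((hf s).sub_const _).mul_const _)
  have hHc : Continuous H := continuous_iff_continuousAt.2 fun s => (hHd s).continuousAt
  have hHa : H a = 0 := by simp [hH]
  have h1 : H a < H b := by
    refine strictMonoOn_of_deriv_pos (convex_Icc a b) hHc.continuousOn (fun s hs => ?_)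
      (Set.left_mem_Icc.2 hab.le) (Set.right_mem_Icc.2 hab.le) hab
    rw [interior_Icc] at hs
    rw [(hHd s).deriv]
    exact hpos s hs
  have h2 : H b + Real.cos (θ b) < H a + Real.cos (θ a) := by
    refine strictAntiOn_of_deriv_neg (f := fun s => H s + Real.cos (θ s)) (convex_Icc a b)
      (hHc.add (Real.continuous_cos.comp hθc)).continuousOn (fun s hs => ?_)
      (Set.left_mem_Icc.2 hab.le) (Set.right_mem_Icc.2 hab.le) hab
    rw [interior_Icc] at hs
    have hd : HasDerivAt (fun s => H s + Real.cos (θ s)) _ s := (hHd s).add (hθd s).cos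
    rw [hd.deriv]
    nlinarith [hpos s hs, hκ s]
  refine ⟨b, ?_, ?_, ?_, ?_⟩
  · have := hF b
    simp only [hb, Real.cos_pi, Real.sin_pi] at this
    linarith
  · have := hG b
    simp only [hb, Real.cos_pi, Real.sin_pi] at this
    linarith
  · rwa [hHa] at h1
  · rw [hHa, hb, hθa, Real.cos_pi, Real.cos_zero] at h2
    change H b < 2
    linarith

lemma dist_eq_one_iff_coord (x y : EuclideanSpace ℝ (Fin 2)) :
    dist x y = 1 ↔ (x 0 - y 0) ^ 2 + (x 1 - y 1) ^ 2 = 1 := by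
  rw [EuclideanSpace.dist_eq, Real.sqrt_eq_one]
  simp [Fin.sum_univ_two, Real.dist_eq]

lemma dist_le_one_iff_coord (x y : EuclideanSpace ℝ (Fin 2)) :
    dist x y ≤ 1 ↔ (x 0 - y 0) ^ 2 + (x 1 - y 1) ^ 2 ≤ 1 := by
  rw [EuclideanSpace.dist_eq, Real.sqrt_le_one]
  simp [Fin.sum_univ_two, Real.dist_eq]

lemma ext_coord {x y : EuclideanSpace ℝ (Fin 2)} (h0 : x 0 = y 0) (h1 : x 1 = y 1) : x = y := by
  ext i
  fin_cases i
  exacts [h0, h1]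

/-- The centres of the two unit circles through `x` and `y` form a rhombus with `x` and `y`. -/
lemma centers_add_eq {x y p q : EuclideanSpace ℝ (Fin 2)} (hxy : x ≠ y) (hpq : p ≠ q)
    (hxp : dist x p = 1) (hyp : dist y p = 1) (hxq : dist x q = 1) (hyq : dist y q = 1) :
    p + q = x + y := by
  rw [dist_eq_one_iff_coord] at hxp hyp hxq hyq
  have hd : 0 < (x 0 - y 0) ^ 2 + (x 1 - y 1) ^ 2 := by
    by_contra! h
    exact hxy (ext_coord (by nlinarith [sq_nonneg (x 0 - y 0), sq_nonneg (x 1 - y 1)])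
      (by nlinarith [sq_nonneg (x 0 - y 0), sq_nonneg (x 1 - y 1)]))
  have he : 0 < (p 0 - q 0) ^ 2 + (p 1 - q 1) ^ 2 := by
    by_contra! h
    exact hpq (ext_coord (by nlinarith [sq_nonneg (p 0 - q 0), sq_nonneg (p 1 - q 1)])
      (by nlinarith [sq_nonneg (p 0 - q 0), sq_nonneg (p 1 - q 1)]))
  set d0 := x 0 - y 0
  set d1 := x 1 - y 1
  set e0 := p 0 - q 0
  set e1 := p 1 - q 1
  set w0 := p 0 + q 0 - (x 0 + y 0)
  set w1 := p 1 + q 1 - (x 1 + y 1)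
  have h1 : d0 * e0 + d1 * e1 = 0 := by
    simp only [d0, d1, e0, e1]; linear_combination (hxq - hxp - hyq + hyp) / 2
  have h2 : w0 * d0 + w1 * d1 = 0 := by
    simp only [d0, d1, w0, w1]; linear_combination (hyp - hxp + hyq - hxq) / 2
  have h3 : w0 * e0 + w1 * e1 = 0 := by
    simp only [e0, e1, w0, w1]; linear_combination (hxp - hxq + hyp - hyq) / 2
  have hdet : d0 * e1 - d1 * e0 ≠ 0 := by
    intro h
    have : (d0 ^ 2 + d1 ^ 2) * (e0 ^ 2 + e1 ^ 2) = 0 := by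
      linear_combination (d0 * e0 + d1 * e1) * h1 + (d0 * e1 - d1 * e0) * h
    exact (mul_pos hd he).ne' this
  have hw0 : w0 = 0 := mul_left_cancel₀ hdet (by linear_combination e1 * h2 - d1 * h3)
  have hw1 : w1 = 0 := mul_left_cancel₀ hdet (by linear_combination d0 * h3 - e0 * h2)
  refine ext_coord ?_ ?_
  · simp only [PiLp.add_apply]; linarith
  · simp only [PiLp.add_apply]; linarith

lemma hasDerivAt_coord {γ : ℝ → EuclideanSpace ℝ (Fin 2)} {γ' : EuclideanSpace ℝ (Fin 2)} {s : ℝ}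
    (h : HasDerivAt γ γ' s) (i : Fin 2) : HasDerivAt (fun t => γ t i) (γ' i) s :=
  (EuclideanSpace.proj i : EuclideanSpace ℝ (Fin 2) →L[ℝ] ℝ).hasFDerivAt.comp_hasDerivAt s h

/-- At a point of a curve in a closed unit disc that lies on its boundary circle, the tangent is
orthogonal to the radius. -/
lemma tangent_orthogonal_radius {γ : ℝ → EuclideanSpace ℝ (Fin 2)}
    {p γ' : EuclideanSpace ℝ (Fin 2)} {s : ℝ} (hγ : HasDerivAt γ γ' s)
    (hle : ∀ t, dist (γ t) p ≤ 1) (hs : dist (γ s) p = 1) :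
    (γ s 0 - p 0) * γ' 0 + (γ s 1 - p 1) * γ' 1 = 0 := by
  have hd : HasDerivAt (fun t => (γ t 0 - p 0) ^ 2 + (γ t 1 - p 1) ^ 2) _ s :=
    (((hasDerivAt_coord hγ 0).sub_const (p 0)).pow 2).add
      (((hasDerivAt_coord hγ 1).sub_const (p 1)).pow 2)
  have hmax : IsLocalMax (fun t => (γ t 0 - p 0) ^ 2 + (γ t 1 - p 1) ^ 2) s :=
    Filter.Eventually.of_forall fun t => by
      have h1 := (dist_le_one_iff_coord _ _).1 (hle t)
      have h2 := (dist_eq_one_iff_coord _ _).1 hs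
      simpa only [h2] using h1
  have := hmax.hasDerivAt_eq_zero hd
  norm_num at this
  linarith

/-- If the caps cut off a convex body by unit discs have area tending to zero, the limiting
disc contains the body. -/
lemma subset_closedBall_of_cap_area_tendsto_zero {K : Set (EuclideanSpace ℝ (Fin 2))}
    (hKcomp : IsCompact K) (hKconv : Convex ℝ K) (hKint : (interior K).Nonempty)
    {p : ℕ → EuclideanSpace ℝ (Fin 2)} {p' : EuclideanSpace ℝ (Fin 2)}
    (hp : Filter.Tendsto p Filter.atTop (nhds p'))
    (hA : Filter.Tendsto (fun n => (volume (K \ ball (p n) 1)).toReal) Filter.atTop (nhds 0)) :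
    K ⊆ closedBall p' 1 := by
  have hcl : K ⊆ closure (interior K) := by
    rw [hKconv.closure_interior_eq_closure_of_nonempty_interior hKint]
    exact subset_closure
  refine hcl.trans (closure_minimal (fun z hz => ?_) isClosed_closedBall)
  by_contra hzp
  rw [mem_closedBall, not_le] at hzp
  obtain ⟨r, hr, hrK⟩ := Metric.isOpen_iff.1 isOpen_interior z hz
  set ρ := min r ((dist z p' - 1) / 2) with hρ
  have hρ0 : 0 < ρ := lt_min hr (by linarith)
  have hvol : 0 < (volume (ball z ρ)).toReal :=
    ENNReal.toReal_pos (measure_ball_pos _ _ hρ0).ne' measure_ball_lt_top.ne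
  have hclose : ∀ᶠ n in Filter.atTop, dist (p n) p' < (dist z p' - 1) / 2 :=
    hp.eventually (ball_mem_nhds p' (by linarith))
  obtain ⟨n, hn1, hn2⟩ := (hclose.and (hA.eventually_lt_const hvol)).exists
  refine absurd hn2 (not_lt.2 ?_)
  refine ENNReal.toReal_mono
    ((measure_mono Set.sdiff_subset).trans_lt hKcomp.measure_lt_top).ne (measure_mono fun w hw => ?_)
  rw [mem_ball] at hw
  refine ⟨interior_subset (hrK (hw.trans_le (min_le_left _ _))), fun hwp => ?_⟩
  rw [mem_ball] at hwp
  have h1 := dist_triangle z w p'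
  have h2 := dist_triangle w (p n) p'
  rw [dist_comm z w] at h1
  linarith [min_le_right r ((dist z p' - 1) / 2)]

/-- At a boundary point `γ s` of a convex body bounded by a regular curve, the body lies on one
side of the tangent line. -/
lemma one_side_of_tangent {K : Set (EuclideanSpace ℝ (Fin 2))} (hKconv : Convex ℝ K)
    (hKint : (interior K).Nonempty) {γ : ℝ → EuclideanSpace ℝ (Fin 2)}
    {T : EuclideanSpace ℝ (Fin 2)} {s : ℝ} (hγ : HasDerivAt γ T s) (hT : T 0 ^ 2 + T 1 ^ 2 = 1)
    (hγK : ∀ t, γ t ∈ K) (hs : γ s ∉ interior K) :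
    ∃ c : ℝ, c ≠ 0 ∧
      ∀ z ∈ K, c * ((z 1 - γ s 1) * T 0 - (z 0 - γ s 0) * T 1) ≤ 0 := by
  obtain ⟨φ, hφ⟩ := geometric_hahn_banach_open_point hKconv.interior isOpen_interior hs
  have hφK : ∀ z ∈ K, φ z ≤ φ (γ s) := by
    have hcl : K ⊆ closure (interior K) := by
      rw [hKconv.closure_interior_eq_closure_of_nonempty_interior hKint]
      exact subset_closure
    exact hcl.trans (closure_minimal (fun z hz => (hφ z hz).le)
      (isClosed_le φ.continuous continuous_const))
  have hφT : φ T = 0 := by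
    have hmax : IsLocalMax (fun t => φ (γ t)) s :=
      Filter.Eventually.of_forall fun t => hφK _ (hγK t)
    exact hmax.hasDerivAt_eq_zero (φ.hasFDerivAt.comp_hasDerivAt s hγ)
  set N : EuclideanSpace ℝ (Fin 2) := !₂[-T 1, T 0] with hN
  have key : ∀ z, φ z - φ (γ s) = φ N * ((z 1 - γ s 1) * T 0 - (z 0 - γ s 0) * T 1) := by
    intro z
    have hz : z - γ s = ((z 0 - γ s 0) * T 0 + (z 1 - γ s 1) * T 1) • T +
        ((z 1 - γ s 1) * T 0 - (z 0 - γ s 0) * T 1) • N := by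
      refine ext_coord ?_ ?_
      · simp [hN]; linear_combination -(z 0 - γ s 0) * hT
      · simp [hN]; linear_combination -(z 1 - γ s 1) * hT
    rw [← map_sub, hz, map_add, map_smul, map_smul, hφT, smul_zero, zero_add, smul_eq_mul, mul_comm]
  refine ⟨φ N, fun h => ?_, fun z hz => ?_⟩
  · obtain ⟨z, hz⟩ := hKint
    have := key z
    rw [h, zero_mul] at this
    linarith [hφ z hz]
  · rw [← key z]
    linarith [hφK z hz]

/-- If a unit disc contains the points `w` and `z`, has `w` on its boundary circle with tangent
direction `(u, v)`, and `z` lies strictly to the left of that tangent, then its centre is the unit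
left normal translated to `w`. -/
lemma center_eq_of_tangent {w z r : EuclideanSpace ℝ (Fin 2)} {u v : ℝ} (hT : u ^ 2 + v ^ 2 = 1)
    (hwr : dist w r = 1) (hzr : dist z r ≤ 1)
    (hr : (w 0 - r 0) * u + (w 1 - r 1) * v = 0)
    (hpos : 0 < (z 1 - w 1) * u - (z 0 - w 0) * v) : r 0 = w 0 - v ∧ r 1 = w 1 + u := by
  rw [dist_eq_one_iff_coord] at hwr
  rw [dist_le_one_iff_coord] at hzr
  set m := (r 1 - w 1) * u - (r 0 - w 0) * v with hm
  have h0 : r 0 - w 0 = -m * v := by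
    rw [hm]; linear_combination -(r 0 - w 0) * hT - u * hr
  have h1 : r 1 - w 1 = m * u := by
    rw [hm]; linear_combination -(r 1 - w 1) * hT - v * hr
  have hm2 : m ^ 2 = 1 := by
    rw [← hwr]
    linear_combination -m ^ 2 * hT - (r 0 - w 0 - m * v) * h0 - (r 1 - w 1 + m * u) * h1
  have hm1 : m = 1 := by
    rcases mul_self_eq_one_iff.1 (sq m ▸ hm2) with h | h
    · exact h
    · rw [h] at h0 h1
      have e0 : r 0 = w 0 + v := by linarith
      have e1 : r 1 = w 1 - u := by linarith
      rw [e0, e1] at hzr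
      nlinarith [sq_nonneg (z 0 - w 0), sq_nonneg (z 1 - w 1)]
  rw [hm1] at h0 h1
  constructor <;> linarith

/-- For a planar convex body `K` with `C²` boundary of curvature `> 1` everywhere, there
is a `δ > 0` depending only on `K` such that for any two distinct interior points `x, y`
of `K`, the larger of the two disc-caps of `K` cut off by the two unit circles through
`x` and `y` has area greater than `δ`. -/
theorem larger_disc_cap_area_bound
    (K : Set (EuclideanSpace ℝ (Fin 2)))
    (hKcomp : IsCompact K) (hKconv : Convex ℝ K) (hKint : (interior K).Nonempty)
    (γ : ℝ → EuclideanSpace ℝ (Fin 2)) (hγ : ContDiff ℝ 2 γ)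
    (hγspeed : ∀ s, ‖deriv γ s‖ = 1)
    (hγrange : frontier K = Set.range γ)
    (κ : ℝ → ℝ)
    (hκdef : ∀ s, κ s =
      deriv γ s 0 * deriv (deriv γ) s 1 - deriv γ s 1 * deriv (deriv γ) s 0)
    (hκ : ∀ s, 1 < κ s) :
    ∃ δ : ℝ, 0 < δ ∧
      ∀ x ∈ interior K, ∀ y ∈ interior K, x ≠ y →
        ∀ p₁ p₂ : EuclideanSpace ℝ (Fin 2), p₁ ≠ p₂ →
          dist x p₁ = 1 → dist y p₁ = 1 → dist x p₂ = 1 → dist y p₂ = 1 →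
          δ < max (volume (K \ ball p₁ 1)).toReal (volume (K \ ball p₂ 1)).toReal := by
  have hKcl := hKcomp.isClosed
  have hγK : ∀ t, γ t ∈ K := fun t =>
    hKcl.frontier_subset (hγrange ▸ Set.mem_range_self t)
  have hγint : ∀ t, γ t ∉ interior K := fun t =>
    (hγrange ▸ Set.mem_range_self t : γ t ∈ frontier K).2
  have hγd : ∀ s, HasDerivAt γ (deriv γ s) s := fun s =>
    (hγ.differentiable (by norm_num) s).hasDerivAt
  have hγ' : ContDiff ℝ 1 (deriv γ) := ((contDiff_succ_iff_deriv (n := 1)).1 hγ).2.2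
  have hγd2 : ∀ s, HasDerivAt (deriv γ) (deriv (deriv γ) s) s := fun s =>
    (hγ'.differentiable (by norm_num) s).hasDerivAt
  have hunit : ∀ s, deriv γ s 0 ^ 2 + deriv γ s 1 ^ 2 = 1 := by
    intro s
    have := hγspeed s
    rw [EuclideanSpace.norm_eq, Real.sqrt_eq_one] at this
    simpa [Fin.sum_univ_two] using this
  have horth : ∀ s, deriv γ s 0 * deriv (deriv γ) s 0 + deriv γ s 1 * deriv (deriv γ) s 1 = 0 := by
    intro s
    have h : HasDerivAt (fun s => deriv γ s 0 ^ 2 + deriv γ s 1 ^ 2) _ s :=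
      ((hasDerivAt_coord (hγd2 s) 0).pow 2).add ((hasDerivAt_coord (hγd2 s) 1).pow 2)
    have h' := h.unique (by simpa only [hunit] using hasDerivAt_const s (1 : ℝ))
    norm_num at h'
    linarith
  have hκc : Continuous κ := by
    have h1 : Continuous (deriv γ) := hγ'.continuous
    have h2 : Continuous (deriv (deriv γ)) := hγ'.continuous_deriv le_rfl
    rw [funext hκdef]
    fun_prop
  have hturn := fun s => exists_opposite_tangent (fun s => hasDerivAt_coord (hγd s) 0)
    (fun s => hasDerivAt_coord (hγd s) 1) (κ := κ)
    (fun s => by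
      convert hasDerivAt_coord (hγd2 s) 0 using 1
      rw [hκdef]
      linear_combination deriv (deriv γ) s 0 * hunit s - deriv γ s 0 * horth s)
    (fun s => by
      convert hasDerivAt_coord (hγd2 s) 1 using 1
      rw [hκdef]
      linear_combination deriv (deriv γ) s 1 * hunit s - deriv γ s 1 * horth s)
    hunit hκc hκ s
  by_contra! hcon
  choose! x hx y hy hxy p q hpq hxp hyp hxq hyq hA using
    fun n : ℕ => hcon (1 / ((n : ℝ) + 1)) Nat.one_div_pos_of_nat
  have hC : IsCompact (cthickening 1 K) := hKcomp.cthickening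
  have hmem : ∀ n, (x n, y n, p n, q n) ∈
      K ×ˢ K ×ˢ cthickening 1 K ×ˢ cthickening 1 K := fun n =>
    ⟨interior_subset (hx n), interior_subset (hy n),
      mem_cthickening_of_dist_le _ (x n) _ _ (interior_subset (hx n)) (dist_comm (x n) _ ▸ hxp n).le,
      mem_cthickening_of_dist_le _ (x n) _ _ (interior_subset (hx n)) (dist_comm (x n) _ ▸ hxq n).le⟩
  obtain ⟨⟨x', y', p', q'⟩, ⟨hx'K, hy'K, -, -⟩, ν, hν, hlim⟩ :=
    (hKcomp.prod (hKcomp.prod (hC.prod hC))).tendsto_subseq hmem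
  have hlx : Filter.Tendsto (x ∘ ν) Filter.atTop (nhds x') := hlim.fst_nhds
  have hly : Filter.Tendsto (y ∘ ν) Filter.atTop (nhds y') := hlim.snd_nhds.fst_nhds
  have hlp : Filter.Tendsto (p ∘ ν) Filter.atTop (nhds p') := hlim.snd_nhds.snd_nhds.fst_nhds
  have hlq : Filter.Tendsto (q ∘ ν) Filter.atTop (nhds q') := hlim.snd_nhds.snd_nhds.snd_nhds
  have hsmall : Filter.Tendsto (fun n => 1 / ((ν n : ℝ) + 1)) Filter.atTop (nhds 0) :=
    tendsto_one_div_add_atTop_nhds_zero_nat.comp hν.tendsto_atTop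
  have hKp : K ⊆ closedBall p' 1 :=
    subset_closedBall_of_cap_area_tendsto_zero hKcomp hKconv hKint hlp
      (squeeze_zero (fun _ => ENNReal.toReal_nonneg)
        (fun n => (le_max_left _ _).trans (hA (ν n))) hsmall)
  have hKq : K ⊆ closedBall q' 1 :=
    subset_closedBall_of_cap_area_tendsto_zero hKcomp hKconv hKint hlq
      (squeeze_zero (fun _ => ENNReal.toReal_nonneg)
        (fun n => (le_max_right _ _).trans (hA (ν n))) hsmall)
  have hxp' : dist x' p' = 1 :=
    tendsto_nhds_unique (hlx.dist hlp) (by simp [hxp])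
  have hxq' : dist x' q' = 1 :=
    tendsto_nhds_unique (hlx.dist hlq) (by simp [hxq])
  have hsum : p' + q' = x' + y' :=
    tendsto_nhds_unique (hlp.add hlq) ((hlx.add hly).congr fun n =>
      (centers_add_eq (hxy _) (hpq _) (hxp _) (hyp _) (hxq _) (hyq _)).symm)
  have hx'int : x' ∉ interior K := fun h => by
    have := interior_mono hKp h
    rw [interior_closedBall _ one_ne_zero, mem_ball] at this
    linarith
  obtain ⟨a, rfl⟩ : x' ∈ Set.range γ := hγrange ▸ ⟨subset_closure hx'K, hx'int⟩
  have hp1 := tangent_orthogonal_radius (hγd a) (fun t => hKp (hγK t)) hxp'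
  have hq1 := tangent_orthogonal_radius (hγd a) (fun t => hKq (hγK t)) hxq'
  obtain ⟨b, hb0, hb1, hpos, hlt⟩ := hturn a
  have hT := hunit a
  obtain ⟨c, hc0, hc⟩ := one_side_of_tangent hKconv hKint (hγd b) (hunit b) hγK (hγint b)
  have hy2 := hc _ hy'K
  have hx2 := hc _ hx'K
  rw [hb0, hb1] at hy2 hx2
  set u := deriv γ a 0
  set v := deriv γ a 1
  obtain ⟨hp0, hp1⟩ := center_eq_of_tangent hT hxp' (hKp (hγK b)) hp1 hpos
  obtain ⟨hq0, hq1⟩ := center_eq_of_tangent hT hxq' (hKq (hγK b)) hq1 hpos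
  have hs0 := congrArg (fun z : EuclideanSpace ℝ (Fin 2) => z 0) hsum
  have hs1 := congrArg (fun z : EuclideanSpace ℝ (Fin 2) => z 1) hsum
  simp only [PiLp.add_apply] at hs0 hs1
  have hy0 : y' 0 = γ a 0 - 2 * v := by linarith
  have hy1 : y' 1 = γ a 1 + 2 * u := by linarith
  set h := (γ b 1 - γ a 1) * u - (γ b 0 - γ a 0) * v with hh
  have hx3 : c * h ≤ 0 := by
    rw [hh]; linarith
  have hy3 : 0 ≤ c * (2 - h) := by
    rw [hy0, hy1] at hy2
    have : c * (2 - h) = -(c * ((γ a 1 + 2 * u - γ b 1) * -u - (γ a 0 - 2 * v - γ b 0) * -v)) := by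
      rw [hh]; linear_combination -2 * c * hT
    linarith
  rcases lt_or_gt_of_ne hc0 with hc' | hc'
  · exact (mul_neg_of_neg_of_pos hc' (by linarith)).not_ge hy3
  · exact (mul_pos hc' hpos).not_ge hx3
end
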